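/- arXiv:2305.14801 — 3 statements merged into one kernel-verified Lean document; each statement's English description precedes it below -/
import Mathlib

section
/- Let Ω ⊂ ℝ^N be a bounded open set and let W : Ω × Ω × ℝ^{d×N} × ℝ^{d×N} → ℝ be a normal integrand, bounded from below, such that W(x,y,·,·) is separately curl Young quasiconvex for L^N⊗L^N-a.e. (x,y) ∈ Ω × Ω. Define F : W^{1,∞}(Ω;ℝ^d) → ℝ by F(u) = esssup_{(x,y)∈Ω×Ω} W(x,y,∇u(x),∇u(y)). Then F is sequentially weakly* lower semicontinuous on W^{1,∞}(Ω;ℝ^d): whenever u_j ⇀* u weakly* in W^{1,∞}(Ω;ℝ^d), one has F(u) ≤ liminf_{j→∞} F(u_j). -/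
open MeasureTheory Filter Topology Bornology ZeroAtInfty NNReal ENNReal

noncomputable section

/-- A Young measure on `E`, parametrized over `(α, μ)`: a weakly* measurable family of
probability measures. -/
def IsYoungMeasure {α E : Type*} [MeasurableSpace α] [MeasurableSpace E] [TopologicalSpace E]
    (μ : Measure α) (ν : α → Measure E) : Prop :=
  (∀ᵐ x ∂μ, IsProbabilityMeasure (ν x)) ∧
  ∀ φ : C₀(E, ℝ), Measurable fun x => ∫ ξ, φ ξ ∂(ν x)

/-- The sequence of measurable functions `z j` generates the Young measure `ν`:
for every `h ∈ L¹` and every `φ ∈ C₀`, `∫ h(x) φ(z_j(x)) dx → ∫ h(x) ⟨ν_x, φ⟩ dx`. -/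
def GeneratesYM {α E : Type*} [MeasurableSpace α] [MeasurableSpace E] [TopologicalSpace E]
    (μ : Measure α) (z : ℕ → α → E) (ν : α → Measure E) : Prop :=
  (∀ j, Measurable (z j)) ∧ IsYoungMeasure μ ν ∧
  ∀ h : α → ℝ, Integrable h μ → ∀ φ : C₀(E, ℝ),
    Tendsto (fun j => ∫ x, h x * φ (z j x) ∂μ) atTop
      (𝓝 (∫ x, h x * ∫ ξ, φ ξ ∂(ν x) ∂μ))

/-- The gradient matrix `∇u(x) ∈ ℝ^{d×N}` of `u : ℝ^N → ℝ^d`. -/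
def gradMatrix {N d : ℕ} (u : (Fin N → ℝ) → (Fin d → ℝ)) (x : Fin N → ℝ) :
    Fin d → Fin N → ℝ :=
  fun i j => fderiv ℝ u x (Pi.single j 1) i

/-- A `W^{1,∞}`-gradient Young measure on a set `Ω ⊆ ℝ^N`: a Young measure generated by the
gradients of a bounded sequence in `W^{1,∞}(Ω;ℝ^d)`. -/
def IsGradientYoungMeasure {N d : ℕ} (Ω : Set (Fin N → ℝ))
    (ν : (Fin N → ℝ) → Measure (Fin d → Fin N → ℝ)) : Prop :=
  ∃ u : ℕ → (Fin N → ℝ) → (Fin d → ℝ),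
    (∃ C : ℝ≥0, ∀ j, LipschitzWith C (u j) ∧ ∀ x, ‖u j x‖ ≤ C) ∧
    GeneratesYM (volume.restrict Ω) (fun j x => gradMatrix (u j) x) ν

/-- A homogeneous `W^{1,∞}`-gradient Young measure: a probability measure `ν₀` on `ℝ^{d×N}`
such that the constant family `ν_x = ν₀` is a gradient Young measure on some bounded
nonempty open set. -/
def IsHomogeneousGradientYM {N d : ℕ} (ν : Measure (Fin d → Fin N → ℝ)) : Prop :=
  IsProbabilityMeasure ν ∧ ∃ Ω : Set (Fin N → ℝ), IsOpen Ω ∧ Ω.Nonempty ∧ IsBounded Ω ∧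
    IsGradientYoungMeasure Ω (fun _ => ν)

/-- `W : ℝ^{d×N} × ℝ^{d×N} → ℝ` is separately curl Young quasiconvex. -/
def SeparatelyCurlYoungQuasiconvex {N d : ℕ}
    (W : (Fin d → Fin N → ℝ) → (Fin d → Fin N → ℝ) → ℝ) : Prop :=
  ∀ ν μ : Measure (Fin d → Fin N → ℝ),
    IsHomogeneousGradientYM ν → IsHomogeneousGradientYM μ →
    (W (∫ ξ, ξ ∂ν) (∫ ζ, ζ ∂μ) : EReal) ≤
      essSup (fun ξ => essSup (fun ζ => (W ξ ζ : EReal)) μ) ν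


/-- Weak* convergence `u_j ⇀* u₀` in `W^{1,∞}(Ω;ℝ^d)`: the sequence is bounded in `W^{1,∞}`
and both the functions and their gradients converge weakly* in `L^∞`, i.e. tested against
arbitrary `L¹` functions. -/
def WeakStarConvW1inf {N d : ℕ} (Ω : Set (Fin N → ℝ))
    (u : ℕ → (Fin N → ℝ) → (Fin d → ℝ)) (u₀ : (Fin N → ℝ) → (Fin d → ℝ)) : Prop :=
  (∃ C : ℝ≥0, ∀ j, LipschitzWith C (u j) ∧ ∀ x, ‖u j x‖ ≤ C) ∧
  ∀ h : (Fin N → ℝ) → ℝ, Integrable h (volume.restrict Ω) →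
    (∀ i : Fin d, Tendsto (fun j => ∫ x in Ω, h x * u j x i) atTop
      (𝓝 (∫ x in Ω, h x * u₀ x i))) ∧
    (∀ (i : Fin d) (k : Fin N), Tendsto (fun j => ∫ x in Ω, h x * gradMatrix (u j) x i k) atTop
      (𝓝 (∫ x in Ω, h x * gradMatrix u₀ x i k)))

lemma ym_tendsto_of_approx {ι : Type*} {l : Filter ι} {a : ι → ℝ} {a' : ℝ}
    (H : ∀ ε > 0, ∃ (b : ι → ℝ) (b' : ℝ), Tendsto b l (𝓝 b') ∧ (∀ᶠ i in l, |a i - b i| ≤ ε) ∧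
      |a' - b'| ≤ ε) : Tendsto a l (𝓝 a') := by
  rw [Metric.tendsto_nhds]
  intro ε hε
  obtain ⟨b, b', hb, h1, h2⟩ := H (ε / 4) (by positivity)
  filter_upwards [h1, (Metric.tendsto_nhds.1 hb) (ε / 4) (by positivity)] with i h3 h4
  rw [Real.dist_eq] at h4 ⊢
  rw [abs_le] at h2 h3
  rw [abs_lt] at h4 ⊢
  constructor <;> linarith [h2.1, h2.2, h3.1, h3.2, h4.1, h4.2]

lemma ym_integral_bound {X : Type*} [MeasurableSpace X] {μ : Measure X} {h g a : X → ℝ} {M ε : ℝ}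
    (hh : Integrable h μ) (hg : Integrable g μ) (ha : AEStronglyMeasurable a μ)
    (haM : ∀ x, |a x| ≤ M) (hgh : ∫ x, ‖h x - g x‖ ∂μ ≤ ε) (hM : 0 ≤ M) :
    |∫ x, h x * a x ∂μ - ∫ x, g x * a x ∂μ| ≤ M * ε := by
  have hha : Integrable (fun x => h x * a x) μ :=
    hh.mul_bdd (c := M) ha (Eventually.of_forall haM)
  have hga : Integrable (fun x => g x * a x) μ :=
    hg.mul_bdd (c := M) ha (Eventually.of_forall haM)
  rw [← integral_sub hha hga]
  calc |∫ x, h x * a x - g x * a x ∂μ| ≤ ∫ x, |h x * a x - g x * a x| ∂μ :=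
        abs_integral_le_integral_abs
    _ ≤ ∫ x, M * ‖h x - g x‖ ∂μ := by
        refine integral_mono (hha.sub hga).abs ((hh.sub hg).norm.const_mul M) fun x => ?_
        simp only [Real.norm_eq_abs]
        rw [← sub_mul, abs_mul, mul_comm]
        exact mul_le_mul_of_nonneg_right (haM x) (abs_nonneg _)
    _ ≤ M * ε := by
        rw [integral_const_mul]
        exact mul_le_mul_of_nonneg_left hgh hM

lemma ym_L1_approx {X : Type*} [MeasurableSpace X] {μ : Measure X} {ι : Type*} {l : Filter ι}
    {h : X → ℝ} {a : ι → X → ℝ} {a' : X → ℝ} {M : ℝ} (hM : 0 ≤ M)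
    (hh : Integrable h μ) (ha : ∀ᶠ i in l, AEStronglyMeasurable (a i) μ)
    (ha' : AEStronglyMeasurable a' μ) (haM : ∀ i x, |a i x| ≤ M) (haM' : ∀ x, |a' x| ≤ M)
    (H : ∀ ε > 0, ∃ g : X → ℝ, Integrable g μ ∧ ∫ x, ‖h x - g x‖ ∂μ ≤ ε ∧
      Tendsto (fun i => ∫ x, g x * a i x ∂μ) l (𝓝 (∫ x, g x * a' x ∂μ))) :
    Tendsto (fun i => ∫ x, h x * a i x ∂μ) l (𝓝 (∫ x, h x * a' x ∂μ)) := by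
  refine ym_tendsto_of_approx fun ε hε => ?_
  obtain ⟨g, hg, hgh, hlim⟩ := H (ε / (M + 1)) (by positivity)
  have key : M * (ε / (M + 1)) ≤ ε := by
    rw [mul_div_assoc', div_le_iff₀ (by positivity)]; nlinarith
  refine ⟨_, _, hlim, ?_, ?_⟩
  · filter_upwards [ha] with i hi
    exact (ym_integral_bound hh hg hi (haM i) hgh hM).trans key
  · exact (ym_integral_bound hh hg ha' haM' hgh hM).trans key

/-- Convergence in the sense of Young measures, with values in a compact space. -/
def YMConv {X K : Type*} [MeasurableSpace X] [MeasurableSpace K] [TopologicalSpace K]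
    (μ : Measure X) (z : ℕ → X → K) (κ : ProbabilityTheory.Kernel X K) : Prop :=
  ∀ h : X → ℝ, Integrable h μ → ∀ φ : C(K, ℝ),
    Tendsto (fun j => ∫ x, h x * φ (z j x) ∂μ) atTop (𝓝 (∫ x, h x * ∫ ξ, φ ξ ∂(κ x) ∂μ))

open ProbabilityTheory in
lemma ym_meas {X K : Type*} [MeasurableSpace X] [MeasurableSpace K] [MetricSpace K]
    [CompactSpace K] [BorelSpace K]
    (κ : Kernel X K) [IsMarkovKernel κ] (φ : C(K, ℝ)) : Measurable fun x => ∫ ξ, φ ξ ∂(κ x) := by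
  have : StronglyMeasurable fun x => ∫ ξ, φ ξ ∂(κ x) :=
    (φ.continuous.stronglyMeasurable).integral_kernel
  exact this.measurable

open ProbabilityTheory in
lemma ym_bound {X K : Type*} [MeasurableSpace X] [MeasurableSpace K] [TopologicalSpace K]
    [CompactSpace K] 
    (κ : Kernel X K) [IsMarkovKernel κ] (φ : C(K, ℝ)) (x : X) : |∫ ξ, φ ξ ∂(κ x)| ≤ ‖φ‖ := by
  have := norm_integral_le_of_norm_le_const (μ := κ x) (f := φ) (C := ‖φ‖)
    (Eventually.of_forall fun y => φ.norm_coe_le_norm y)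
  simpa using this

open ProbabilityTheory in
lemma ym_exists_prob {X K : Type*} [TopologicalSpace X] [PolishSpace X] [MeasurableSpace X]
    [BorelSpace X] [MetricSpace K] [CompactSpace K] [Nonempty K] [MeasurableSpace K] [BorelSpace K]
    (μ : Measure X) [IsProbabilityMeasure μ] (z : ℕ → X → K) (hz : ∀ j, Measurable (z j)) :
    ∃ θ : ℕ → ℕ, StrictMono θ ∧ ∃ κ : Kernel X K, IsMarkovKernel κ ∧
      YMConv μ (fun j => z (θ j)) κ := by
  have hm : ∀ j, Measurable fun x => (x, z j x) := fun j => measurable_id.prodMk (hz j)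
  let ρ : ℕ → ProbabilityMeasure (X × K) := fun j =>
    ⟨μ.map fun x => (x, z j x), Measure.isProbabilityMeasure_map (hm j).aemeasurable⟩
  have hcomp : IsCompact (closure (Set.range ρ)) := by
    apply isCompact_closure_of_isTightMeasureSet
    rw [isTightMeasureSet_iff_exists_isCompact_measure_compl_le]
    intro ε hε
    obtain ⟨A, hA, hAε⟩ := isTightMeasureSet_iff_exists_isCompact_measure_compl_le.1
      (isTightMeasureSet_singleton (μ := μ)) ε hε
    refine ⟨A ×ˢ Set.univ, hA.prod isCompact_univ, ?_⟩
    rintro _ ⟨_, ⟨j, rfl⟩, rfl⟩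
    refine le_trans (le_of_eq ?_) (hAε μ rfl)
    show μ.map (fun x => (x, z j x)) _ = _
    rw [Measure.map_apply (hm j) (hA.isClosed.measurableSet.prod MeasurableSet.univ).compl]
    congr 1
    ext x; simp
  obtain ⟨ρ', -, θ, hθ, hlim⟩ := hcomp.tendsto_subseq (fun j => subset_closure ⟨j, rfl⟩ :
    ∀ j, ρ j ∈ closure (Set.range ρ))
  have hfst : (ρ' : Measure (X × K)).fst = μ := by
    have h1 := (ProbabilityMeasure.continuous_map (Ω := X × K) (Ω' := X) continuous_fst).tendsto ρ' |>.comp hlim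
    have h2 : ∀ j, (ρ j).map (f := Prod.fst) continuous_fst.measurable.aemeasurable = ⟨μ, inferInstance⟩ := by
      intro j
      apply Subtype.ext
      show (μ.map fun x => (x, z j x)).map Prod.fst = μ
      rw [Measure.map_map measurable_fst (hm j)]
      exact Measure.map_id
    have h3 := tendsto_nhds_unique h1 (by
      simp only [Function.comp_def, h2]; exact tendsto_const_nhds)
    have h4 := congrArg Subtype.val h3
    exact h4
  refine ⟨θ, hθ, (ρ' : Measure (X × K)).condKernel, inferInstance, ?_⟩
  set κ := (ρ' : Measure (X × K)).condKernel with hκ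
  have hdis : μ ⊗ₘ κ = (ρ' : Measure (X × K)) := by
    conv_rhs => rw [← (ρ' : Measure (X × K)).disintegrate κ, hfst]
  intro h hh φ
  refine ym_L1_approx (M := ‖φ‖) (norm_nonneg _) hh
    (Eventually.of_forall fun j => (φ.continuous.measurable.comp (hz _)).aestronglyMeasurable)
    (ym_meas κ φ).aestronglyMeasurable (fun j x => φ.norm_coe_le_norm _) (ym_bound κ φ) ?_
  intro ε hε
  let _ := TopologicalSpace.upgradeIsCompletelyMetrizable X
  obtain ⟨g, hg1, hg2⟩ := hh.exists_boundedContinuous_integral_sub_le hε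
  refine ⟨g, hg2, hg1, ?_⟩
  let Ψ : BoundedContinuousFunction (X × K) ℝ := BoundedContinuousFunction.ofNormedAddCommGroup
    (fun p => g p.1 * φ p.2) (by fun_prop) (‖g‖ * ‖φ‖) (fun p => by
      rw [norm_mul]
      exact mul_le_mul (g.norm_coe_le_norm _) (φ.norm_coe_le_norm _) (norm_nonneg _) (norm_nonneg _))
  have := (ProbabilityMeasure.tendsto_iff_forall_integral_tendsto.1 hlim) Ψ
  convert this using 2
  · rename_i j
    show _ = ∫ p, g p.1 * φ p.2 ∂(μ.map fun x => (x, z (θ j) x))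
    rw [integral_map (hm _).aemeasurable]
    exact (Ψ.continuous.measurable).aestronglyMeasurable
  · rw [← hdis, Measure.integral_compProd (hdis ▸ Ψ.integrable _)]
    congr 1
    ext x
    show _ = ∫ y, g x * φ y ∂(κ x)
    rw [integral_const_mul]

open ProbabilityTheory in
lemma ym_exists {X K : Type*} [TopologicalSpace X] [PolishSpace X] [MeasurableSpace X]
    [BorelSpace X] [MetricSpace K] [CompactSpace K] [Nonempty K] [MeasurableSpace K] [BorelSpace K]
    (μ : Measure X) [IsFiniteMeasure μ] (hμ : μ ≠ 0) (z : ℕ → X → K) (hz : ∀ j, Measurable (z j)) :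
    ∃ θ : ℕ → ℕ, StrictMono θ ∧ ∃ κ : Kernel X K, IsMarkovKernel κ ∧
      YMConv μ (fun j => z (θ j)) κ := by
  have : NeZero μ := ⟨hμ⟩
  have h0 : μ Set.univ ≠ 0 := by simpa using hμ
  obtain ⟨θ, hθ, κ, hκ, hc⟩ := ym_exists_prob ((μ Set.univ)⁻¹ • μ) z hz
  refine ⟨θ, hθ, κ, hκ, fun h hh φ => ?_⟩
  have := hc h (hh.smul_measure (ENNReal.inv_ne_top.2 h0)) φ
  simp only [integral_smul_measure] at this
  have h1 : ((μ Set.univ)⁻¹).toReal ≠ 0 := by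
    rw [ENNReal.toReal_ne_zero]
    exact ⟨ENNReal.inv_ne_zero.2 (measure_ne_top _ _), ENNReal.inv_ne_top.2 h0⟩
  have h2 := this.const_smul ((μ Set.univ)⁻¹).toReal⁻¹
  simpa only [smul_smul, inv_mul_cancel₀ h1, one_smul] using h2

open ProbabilityTheory in
lemma ym_product_limit {X K : Type*} [MeasurableSpace X]
    [MetricSpace K] [CompactSpace K] [MeasurableSpace K] [BorelSpace K]
    {μ : Measure X} [IsFiniteMeasure μ] {z : ℕ → X → K} (hz : ∀ j, Measurable (z j))
    {κ : Kernel X K} [IsMarkovKernel κ] (hc : YMConv μ z κ) (J : X × X → ℝ) (hJ : Measurable J)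
    (hJ1 : ∀ p, |J p| ≤ 1) (φ ψ : C(K, ℝ)) :
    Tendsto (fun j => ∫ p, J p * (φ (z j p.1) * ψ (z j p.2)) ∂(μ.prod μ)) atTop
      (𝓝 (∫ p, J p * ((∫ ξ, φ ξ ∂κ p.1) * (∫ ξ, ψ ξ ∂κ p.2)) ∂(μ.prod μ))) := by
  -- general Fubini step
  have fub : ∀ a b : X → ℝ, Measurable a → Measurable b → (∀ x, |a x| ≤ ‖φ‖) →
      (∀ x, |b x| ≤ ‖ψ‖) → ∫ p, J p * (a p.1 * b p.2) ∂(μ.prod μ) =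
        ∫ x, (∫ y, J (x, y) * b y ∂μ) * a x ∂μ := by
    intro a b ha hb haM hbM
    rw [integral_prod]
    · congr 1
      ext x
      rw [← integral_mul_const]
      congr 1
      ext y
      ring
    · refine Integrable.of_bound (by fun_prop) (1 * (‖φ‖ * ‖ψ‖)) (Eventually.of_forall fun p => ?_)
      rw [norm_mul, norm_mul]
      exact mul_le_mul (hJ1 p) (mul_le_mul (haM _) (hbM _) (norm_nonneg _) (norm_nonneg _))
        (by positivity) zero_le_one
  have hφz : ∀ j, Measurable fun x => φ (z j x) := fun j => φ.continuous.measurable.comp (hz j)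
  have hψz : ∀ j, Measurable fun x => ψ (z j x) := fun j => ψ.continuous.measurable.comp (hz j)
  have Tm : ∀ b : X → ℝ, Measurable b → Measurable fun x => ∫ y, J (x, y) * b y ∂μ := by
    intro b hb
    have : StronglyMeasurable fun x => ∫ y, J (x, y) * b y ∂μ :=
      StronglyMeasurable.integral_prod_right' (f := fun p : X × X => J p * b p.2)
        (by fun_prop : Measurable fun p : X × X => J p * b p.2).stronglyMeasurable
    exact this.measurable
  have Tb : ∀ b : X → ℝ, (∀ x, |b x| ≤ ‖ψ‖) → ∀ x, |∫ y, J (x, y) * b y ∂μ| ≤ ‖ψ‖ * μ.real Set.univ := by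
    intro b hb x
    refine norm_integral_le_of_norm_le_const (μ := μ) (f := fun y => J (x, y) * b y) (Eventually.of_forall fun y => ?_)
    rw [norm_mul, ← one_mul ‖ψ‖]
    exact mul_le_mul (hJ1 _) (hb _) (norm_nonneg _) zero_le_one
  rw [fub _ _ (ym_meas κ φ) (ym_meas κ ψ) (ym_bound κ φ) (ym_bound κ ψ)]
  have : (fun j => ∫ p, J p * (φ (z j p.1) * ψ (z j p.2)) ∂(μ.prod μ)) = fun j =>
      (∫ x, ((∫ y, J (x, y) * ψ (z j y) ∂μ) - (∫ y, J (x, y) * ∫ ξ, ψ ξ ∂κ y ∂μ)) * φ (z j x) ∂μ) +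
      ∫ x, (∫ y, J (x, y) * ∫ ξ, ψ ξ ∂κ y ∂μ) * φ (z j x) ∂μ := by
    ext j
    rw [fub _ _ (hφz j) (hψz j) (fun x => φ.norm_coe_le_norm _) (fun x => ψ.norm_coe_le_norm _),
      ← integral_add]
    · congr 1
      ext x
      ring
    · refine Integrable.of_bound
        (((Tm _ (hψz j)).sub (Tm _ (ym_meas κ ψ))).mul (hφz j)).aestronglyMeasurable
        ((‖ψ‖ * μ.real Set.univ + ‖ψ‖ * μ.real Set.univ) * ‖φ‖) (Eventually.of_forall fun x => ?_)
      rw [norm_mul]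
      refine mul_le_mul ((norm_sub_le _ _).trans (add_le_add (Tb _ (fun x => ψ.norm_coe_le_norm _) x)
        (Tb _ (ym_bound κ ψ) x))) (φ.norm_coe_le_norm _) (norm_nonneg _) (by positivity)
    · refine Integrable.of_bound ((Tm _ (ym_meas κ ψ)).mul (hφz j)).aestronglyMeasurable
        ((‖ψ‖ * μ.real Set.univ) * ‖φ‖) (Eventually.of_forall fun x => ?_)
      rw [norm_mul]
      refine mul_le_mul (Tb _ (ym_bound κ ψ) x) (φ.norm_coe_le_norm _) (norm_nonneg _) (by positivity)
  rw [this, ← zero_add (∫ x, _ ∂μ)]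
  refine Tendsto.add ?_ ?_
  · rw [← integral_zero X ℝ (μ := μ)]
    refine tendsto_integral_of_dominated_convergence
      (fun _ => (‖ψ‖ * μ.real Set.univ + ‖ψ‖ * μ.real Set.univ) * ‖φ‖)
      (fun j => (((Tm _ (hψz j)).sub (Tm _ (ym_meas κ ψ))).mul (hφz j)).aestronglyMeasurable)
      (integrable_const _) (fun j => Eventually.of_forall fun x => ?_)
      (Eventually.of_forall fun x => ?_)
    · rw [norm_mul]
      refine mul_le_mul ((norm_sub_le _ _).trans (add_le_add (Tb _ (fun x => ψ.norm_coe_le_norm _) x)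
        (Tb _ (ym_bound κ ψ) x))) (φ.norm_coe_le_norm _) (norm_nonneg _) (by positivity)
    · have h1 : Integrable (fun y => J (x, y)) μ :=
        Integrable.of_bound (hJ.comp measurable_prodMk_left).aestronglyMeasurable 1
          (Eventually.of_forall fun y => hJ1 _)
      have h2 := (hc _ h1 ψ).sub_const (∫ y, J (x, y) * ∫ ξ, ψ ξ ∂κ y ∂μ)
      rw [sub_self] at h2
      exact h2.zero_mul_isBoundedUnder_le ⟨‖φ‖, by
        simp only [eventually_map]
        exact Eventually.of_forall fun j => φ.norm_coe_le_norm _⟩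
  · exact hc _ (Integrable.of_bound (Tm _ (ym_meas κ ψ)).aestronglyMeasurable _
      (Eventually.of_forall (Tb _ (ym_bound κ ψ)))) φ

lemma ym_bump {K : Type*} [MetricSpace K] {B : Set K} (hB : IsOpen B) :
    ∃ f : C(K, ℝ), (∀ x, 0 ≤ f x) ∧ ∀ x, x ∈ B ↔ f x ≠ 0 := by
  by_cases h : (Bᶜ).Nonempty
  · refine ⟨⟨fun x => Metric.infDist x Bᶜ, Metric.continuous_infDist_pt _⟩,
      fun x => Metric.infDist_nonneg, fun x => ?_⟩
    have := hB.isClosed_compl.mem_iff_infDist_zero h (x := x)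
    simp only [ContinuousMap.coe_mk, ne_eq, ← this, Set.mem_compl_iff, not_not]
  · rw [Set.not_nonempty_iff_eq_empty, Set.compl_empty_iff] at h
    exact ⟨ContinuousMap.const K 1, fun x => by simp, fun x => by simp [h]⟩

open ProbabilityTheory in
lemma ym_support_box {X K : Type*} [MeasurableSpace X]
    [MetricSpace K] [CompactSpace K] [MeasurableSpace K] [BorelSpace K]
    {μ : Measure X} [IsFiniteMeasure μ] {z : ℕ → X → K} (hz : ∀ j, Measurable (z j))
    {κ : Kernel X K} [IsMarkovKernel κ] (hc : YMConv μ z κ) (G : X × X → Set (K × K))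
    (hG : ∀ j, ∀ᵐ p ∂(μ.prod μ), (z j p.1, z j p.2) ∉ G p) {A B : Set K} (hA : IsOpen A)
    (hB : IsOpen B) : ∀ᵐ p ∂(μ.prod μ), A ×ˢ B ⊆ G p → ((κ p.1).prod (κ p.2)) (A ×ˢ B) = 0 := by
  obtain ⟨φ, hφ0, hφ⟩ := ym_bump hA
  obtain ⟨ψ, hψ0, hψ⟩ := ym_bump hB
  set P : Set (X × X) := {p | A ×ˢ B ⊆ G p} with hP
  set P' := toMeasurable (μ.prod μ) P with hP'
  have hP'm : MeasurableSet P' := measurableSet_toMeasurable _ _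
  have hJm : Measurable (P'.indicator (fun _ => (1 : ℝ))) := measurable_const.indicator hP'm
  have hlim := ym_product_limit hz hc (P'.indicator (fun _ => (1 : ℝ))) hJm (fun p => by
    by_cases hp : p ∈ P' <;> simp [hp]) φ ψ
  have hzero : ∀ j, ∫ p, P'.indicator (fun _ => (1 : ℝ)) p * (φ (z j p.1) * ψ (z j p.2)) ∂(μ.prod μ) = 0 := by
    intro j
    set S : Set (X × X) := {p | z j p.1 ∈ A ∧ z j p.2 ∈ B} with hS
    have hSm : MeasurableSet S :=
      (((hz j).comp measurable_fst) hA.measurableSet).inter (((hz j).comp measurable_snd) hB.measurableSet)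
    have h0 : (μ.prod μ) (P' ∩ S) = 0 := by
      rw [hP', Measure.measure_toMeasurable_inter hSm (measure_ne_top _ _)]
      refine measure_mono_null ?_ (ae_iff.1 (hG j))
      rintro p ⟨hp1, hp2⟩
      simp only [Set.mem_ofPred_eq, not_not]
      exact hp1 ⟨hp2.1, hp2.2⟩
    apply integral_eq_zero_of_ae
    have h1 : ∀ᵐ p ∂(μ.prod μ), p ∉ P' ∩ S := measure_eq_zero_iff_ae_notMem.1 h0
    filter_upwards [h1] with p hp
    simp only [Pi.zero_apply, mul_eq_zero]
    by_cases hpP : p ∈ P'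
    · right
      by_contra hcon
      push Not at hcon
      exact hp ⟨hpP, (hφ _).2 hcon.1, (hψ _).2 hcon.2⟩
    · left; simp [hpP]
  simp only [hzero] at hlim
  have hIntg := (tendsto_nhds_unique hlim tendsto_const_nhds)
  have hnn : ∀ p : X × X, 0 ≤ P'.indicator (fun _ => (1 : ℝ)) p * ((∫ ξ, φ ξ ∂κ p.1) * (∫ ξ, ψ ξ ∂κ p.2)) := by
    intro p
    refine mul_nonneg (Set.indicator_nonneg (fun _ _ => zero_le_one) _) (mul_nonneg
      (integral_nonneg fun x => hφ0 x) (integral_nonneg fun x => hψ0 x))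
  have hmeas : Measurable fun p : X × X => P'.indicator (fun _ => (1 : ℝ)) p * ((∫ ξ, φ ξ ∂κ p.1) * (∫ ξ, ψ ξ ∂κ p.2)) :=
    hJm.mul (((ym_meas κ φ).comp measurable_fst).mul ((ym_meas κ ψ).comp measurable_snd))
  rw [integral_eq_zero_iff_of_nonneg hnn] at hIntg
  · filter_upwards [hIntg] with p hp hsub
    have hpP : p ∈ P' := subset_toMeasurable _ _ hsub
    have fact : ∀ (f : C(K, ℝ)) (x : X) (C : Set K), (∀ y, 0 ≤ f y) → (∀ y, y ∈ C ↔ f y ≠ 0) →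
        ∫ ξ, f ξ ∂κ x = 0 → (κ x) C = 0 := by
      intro f x C hf hC hI
      rw [integral_eq_zero_iff_of_nonneg hf] at hI
      · rw [measure_eq_zero_iff_ae_notMem]
        filter_upwards [hI] with y hy
        rw [hC]; simpa using hy
      · exact Integrable.of_bound f.continuous.measurable.aestronglyMeasurable ‖f‖
          (Eventually.of_forall fun y => f.norm_coe_le_norm _)
    simp only [hpP, Set.indicator_of_mem, one_mul, Pi.zero_apply, mul_eq_zero] at hp
    rw [Measure.prod_prod]
    rcases hp with hp | hp
    · rw [fact φ _ A hφ0 hφ hp, zero_mul]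
    · rw [fact ψ _ B hψ0 hψ hp, mul_zero]
  · refine Integrable.of_bound hmeas.aestronglyMeasurable (1 * (‖φ‖ * ‖ψ‖))
      (Eventually.of_forall fun p => ?_)
    rw [norm_mul, norm_mul]
    refine mul_le_mul ?_ (mul_le_mul (ym_bound κ φ _) (ym_bound κ ψ _) (norm_nonneg _) (norm_nonneg _))
        (by positivity) zero_le_one
    by_cases hp : p ∈ P' <;> simp [hp]

open ProbabilityTheory in
lemma ym_support {X K : Type*} [MeasurableSpace X]
    [MetricSpace K] [CompactSpace K] [MeasurableSpace K] [BorelSpace K]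
    {μ : Measure X} [IsFiniteMeasure μ] {z : ℕ → X → K} (hz : ∀ j, Measurable (z j))
    {κ : Kernel X K} [IsMarkovKernel κ] (hc : YMConv μ z κ) (G : X × X → Set (K × K))
    (hGo : ∀ᵐ p ∂(μ.prod μ), IsOpen (G p))
    (hG : ∀ j, ∀ᵐ p ∂(μ.prod μ), (z j p.1, z j p.2) ∉ G p) :
    ∀ᵐ p ∂(μ.prod μ), ((κ p.1).prod (κ p.2)) (G p) = 0 := by
  have hb := TopologicalSpace.isBasis_countableBasis K
  have hcount := TopologicalSpace.countable_countableBasis K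
  have hall : ∀ᵐ p ∂(μ.prod μ), ∀ A ∈ TopologicalSpace.countableBasis K,
      ∀ B ∈ TopologicalSpace.countableBasis K, A ×ˢ B ⊆ G p → ((κ p.1).prod (κ p.2)) (A ×ˢ B) = 0 := by
    rw [ae_ball_iff hcount]
    intro A hA
    rw [ae_ball_iff hcount]
    intro B hB
    exact ym_support_box hz hc G hG (hb.isOpen hA) (hb.isOpen hB)
  filter_upwards [hall, hGo] with p hp hpo
  have hcov : G p ⊆ ⋃ A ∈ TopologicalSpace.countableBasis K, ⋃ B ∈ TopologicalSpace.countableBasis K,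
      ⋃ (_ : A ×ˢ B ⊆ G p), A ×ˢ B := by
    rintro ⟨a, b⟩ hab
    obtain ⟨s, ⟨A, hA, B, hB, rfl⟩, hs, hsub⟩ := (hb.prod hb).exists_subset_of_mem_open hab hpo
    simp only [Set.mem_iUnion]
    exact ⟨A, hA, B, hB, hsub, hs⟩
  refine measure_mono_null hcov ?_
  rw [measure_biUnion_null_iff hcount]
  intro A hA
  rw [measure_biUnion_null_iff hcount]
  intro B hB
  rw [measure_iUnion_null_iff]
  exact fun h => hp A hA B hB h

lemma ym_change_var {N : ℕ} (Ω : Set (Fin N → ℝ)) (hΩ : MeasurableSet Ω) (x₀ : Fin N → ℝ) {r : ℝ} (hr : 0 < r)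
    (hsub : ∀ y ∈ Metric.ball (0 : Fin N → ℝ) 1, x₀ + r • y ∈ Ω) (h f : (Fin N → ℝ) → ℝ) :
    ∫ y in Metric.ball (0 : Fin N → ℝ) 1, h y * f (x₀ + r • y) =
      (r ^ N)⁻¹ * ∫ x in Ω, ((Metric.ball (0 : Fin N → ℝ) 1).indicator h) (r⁻¹ • (x - x₀)) * f x := by
  set F : (Fin N → ℝ) → ℝ := fun x =>
    ((Metric.ball (0 : Fin N → ℝ) 1).indicator h) (r⁻¹ • (x - x₀)) * f x with hFdef
  have h1 : ∫ x in Ω, F x = ∫ x, F x := by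
    rw [← integral_indicator hΩ]
    congr 1
    ext x
    by_cases hx : x ∈ Ω
    · simp [hx]
    · rw [Set.indicator_of_notMem hx]
      have : r⁻¹ • (x - x₀) ∉ Metric.ball (0 : Fin N → ℝ) 1 := by
        intro hb
        apply hx
        have := hsub _ hb
        rwa [smul_smul, mul_inv_cancel₀ hr.ne', one_smul, add_sub_cancel] at this
      simp only [hFdef, Set.indicator_of_notMem this, zero_mul]
  rw [h1, ← integral_add_left_eq_self (μ := volume) F x₀, ← integral_indicator measurableSet_ball]
  have h2 := Measure.integral_comp_smul (volume : Measure (Fin N → ℝ)) (fun y => F (x₀ + y)) r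
  rw [Module.finrank_fin_fun, abs_of_pos (by positivity), smul_eq_mul] at h2
  rw [← h2]
  congr 1
  ext y
  simp only [hFdef, add_sub_cancel_left, smul_smul, inv_mul_cancel₀ hr.ne', one_smul]
  by_cases hy : y ∈ Metric.ball (0 : Fin N → ℝ) 1 <;> simp only [Set.indicator_of_mem, Set.indicator_of_notMem, hy, not_false_iff, zero_mul]

lemma ym_lebesgue {N : ℕ} (g : (Fin N → ℝ) → ℝ) (hg : Measurable g) {M : ℝ} (hM : 0 ≤ M) (hgM : ∀ x, |g x| ≤ M) :
    ∀ᵐ x₀ : Fin N → ℝ, ∀ h : (Fin N → ℝ) → ℝ,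
      Integrable h (volume.restrict (Metric.ball (0 : Fin N → ℝ) 1)) →
      Tendsto (fun r : ℝ => ∫ y in Metric.ball (0 : Fin N → ℝ) 1, h y * g (x₀ + r • y)) (𝓝[>] 0)
        (𝓝 (∫ y in Metric.ball (0 : Fin N → ℝ) 1, h y * g x₀)) := by
  have hloc : LocallyIntegrable g (volume : Measure (Fin N → ℝ)) :=
    (locallyIntegrable_const M).mono hg.aestronglyMeasurable (Eventually.of_forall fun x => by
      rw [Real.norm_eq_abs, Real.norm_eq_abs, abs_of_nonneg hM]; exact hgM x)
  filter_upwards [IsUnifLocDoublingMeasure.ae_tendsto_average_norm_sub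
    (volume : Measure (Fin N → ℝ)) hloc 1] with x₀ hx₀ h hh
  have hav := hx₀ (l := 𝓝[>] (0 : ℝ)) (fun _ => x₀) (fun r => r) tendsto_id (by
    filter_upwards [self_mem_nhdsWithin] with r hr
    exact Metric.mem_closedBall_self (by simpa using le_of_lt hr))
  set B := Metric.ball (0 : Fin N → ℝ) 1 with hB
  have : IsFiniteMeasure (volume.restrict B) := ⟨by
    rw [Measure.restrict_apply_univ]; exact measure_ball_lt_top⟩
  have hgc : ∀ r : ℝ, Measurable fun y : Fin N → ℝ => g (x₀ + r • y) := fun r => hg.comp (by fun_prop)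
  have hD : Tendsto (fun r : ℝ => ∫ y in B, |g (x₀ + r • y) - g x₀|) (𝓝[>] 0) (𝓝 0) := by
    have h3 := hav.const_mul (volume.real (Metric.closedBall (0 : Fin N → ℝ) 1))
    rw [mul_zero] at h3
    refine squeeze_zero' (Eventually.of_forall fun r => integral_nonneg fun y => abs_nonneg _) ?_ h3
    filter_upwards [self_mem_nhdsWithin] with r hr
    have hr : 0 < r := hr
    have h4 := ym_change_var (Metric.closedBall x₀ r) measurableSet_closedBall x₀ hr (fun y hy => by
      rw [Metric.mem_closedBall, dist_eq_norm, add_sub_cancel_left, norm_smul, Real.norm_of_nonneg hr.le]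
      have : ‖y‖ < 1 := by simpa using hy
      nlinarith) (fun _ => 1) (fun x => |g x - g x₀|)
    simp only [one_mul] at h4
    rw [h4, setAverage_eq, smul_eq_mul]
    have h5 : volume.real (Metric.closedBall x₀ r) = r ^ N * volume.real (Metric.closedBall (0 : Fin N → ℝ) 1) := by
      have := Measure.addHaar_real_closedBall' (volume : Measure (Fin N → ℝ)) x₀ hr.le
      rwa [Module.finrank_fin_fun] at this
    have h6 : 0 < volume.real (Metric.closedBall (0 : Fin N → ℝ) 1) := by
      rw [measureReal_def]
      exact ENNReal.toReal_pos (Metric.measure_closedBall_pos _ _ one_pos).ne' measure_closedBall_lt_top.ne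
    rw [h5, mul_inv, ← mul_assoc, mul_left_comm, mul_inv_cancel₀ h6.ne', mul_one]
    refine mul_le_mul_of_nonneg_left ?_ (by positivity)
    have hIntg : IntegrableOn (fun x => |g x - g x₀|) (Metric.closedBall x₀ r) := by
      have : IsFiniteMeasure (volume.restrict (Metric.closedBall x₀ r)) := ⟨by
        rw [Measure.restrict_apply_univ]; exact measure_closedBall_lt_top⟩
      refine Integrable.of_bound (by fun_prop) (M + M) (Eventually.of_forall fun x => ?_)
      rw [Real.norm_eq_abs, abs_abs]
      exact (abs_sub _ _).trans (add_le_add (hgM _) (hgM _))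
    refine integral_mono_of_nonneg (Eventually.of_forall fun x => mul_nonneg
      (Set.indicator_nonneg (fun _ _ => zero_le_one) _) (abs_nonneg _)) hIntg
      (Eventually.of_forall fun x => ?_)
    refine (mul_le_mul_of_nonneg_right ?_ (abs_nonneg _)).trans_eq (one_mul _)
    exact Set.indicator_le_self' (fun _ _ => zero_le_one) _
  refine ym_L1_approx hM hh (Eventually.of_forall fun r => (hgc r).aestronglyMeasurable)
    aestronglyMeasurable_const (fun r y => hgM _) (fun _ => hgM _) fun ε hε => ?_
  obtain ⟨q, hq1, hq2⟩ := hh.exists_boundedContinuous_integral_sub_le hε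
  refine ⟨q, hq2, hq1, ?_⟩
  rw [tendsto_iff_norm_sub_tendsto_zero]
  have h7 := hD.const_mul ‖q‖
  rw [mul_zero] at h7
  refine squeeze_zero (fun _ => norm_nonneg _) (fun r => ?_) h7
  have i1 : Integrable (fun y => q y * g (x₀ + r • y)) (volume.restrict B) :=
    hq2.mul_bdd (c := M) (hgc r).aestronglyMeasurable (Eventually.of_forall fun y => hgM _)
  have i2 : Integrable (fun y => q y * g x₀) (volume.restrict B) := hq2.mul_const _
  have i3 : Integrable (fun y => |g (x₀ + r • y) - g x₀|) (volume.restrict B) := by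
    refine Integrable.of_bound ((hgc r).sub_const _).abs.aestronglyMeasurable (M + M) (Eventually.of_forall fun x => ?_)
    rw [Real.norm_eq_abs, abs_abs]
    exact (abs_sub _ _).trans (add_le_add (hgM _) (hgM _))
  rw [← integral_sub i1 i2, ← integral_const_mul]
  refine (norm_integral_le_integral_norm _).trans (integral_mono (i1.sub i2).norm (i3.const_mul _) fun y => ?_)
  simp only
  rw [← mul_sub, norm_mul]
  exact mul_le_mul_of_nonneg_right (q.norm_coe_le_norm y) (abs_nonneg _)

open ProbabilityTheory in
lemma ym_rescale {N : ℕ} {K : Type*} [MetricSpace K] [CompactSpace K] [MeasurableSpace K] [BorelSpace K]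
    {Ω : Set (Fin N → ℝ)} (hΩ : IsOpen Ω) {z : ℕ → (Fin N → ℝ) → K}
    {κ : Kernel (Fin N → ℝ) K} (hc : YMConv (volume.restrict Ω) z κ)
    (x₀ : Fin N → ℝ) {r : ℝ} (hr : 0 < r)
    (hsub : ∀ y ∈ Metric.ball (0 : Fin N → ℝ) 1, x₀ + r • y ∈ Ω) (h : (Fin N → ℝ) → ℝ)
    (hh : Integrable h (volume.restrict (Metric.ball (0 : Fin N → ℝ) 1))) (φ : C(K, ℝ)) :
    Tendsto (fun j => ∫ y in Metric.ball (0 : Fin N → ℝ) 1, h y * φ (z j (x₀ + r • y))) atTop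
      (𝓝 (∫ y in Metric.ball (0 : Fin N → ℝ) 1, h y * ∫ ξ, φ ξ ∂(κ (x₀ + r • y)))) := by
  simp only [fun j => ym_change_var Ω hΩ.measurableSet x₀ hr hsub h (fun x => φ (z j x)),
    ym_change_var Ω hΩ.measurableSet x₀ hr hsub h (fun x => ∫ ξ, φ ξ ∂(κ x))]
  refine (hc _ ?_ φ).const_mul _
  have h1 : Integrable ((Metric.ball (0 : Fin N → ℝ) 1).indicator h) volume :=
    (integrable_indicator_iff measurableSet_ball).2 hh
  exact ((h1.comp_smul (inv_ne_zero hr.ne')).comp_sub_right x₀).integrableOn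

open ProbabilityTheory in
lemma ym_blowup {N : ℕ} {K : Type*} [MetricSpace K] [CompactSpace K] [MeasurableSpace K] [BorelSpace K]
    {Ω : Set (Fin N → ℝ)} (hΩ : IsOpen Ω) {z : ℕ → (Fin N → ℝ) → K} (hz : ∀ j, Measurable (z j))
    {κ : Kernel (Fin N → ℝ) K} [IsMarkovKernel κ] (hc : YMConv (volume.restrict Ω) z κ) :
    ∀ᵐ x₀ ∂(volume.restrict Ω), ∃ (r : ℕ → ℝ) (J : ℕ → ℕ), (∀ k, 0 < r k) ∧
      ∀ h : (Fin N → ℝ) → ℝ, Integrable h (volume.restrict (Metric.ball (0 : Fin N → ℝ) 1)) →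
      ∀ φ : C(K, ℝ),
      Tendsto (fun k => ∫ y in Metric.ball (0 : Fin N → ℝ) 1, h y * φ (z (J k) (x₀ + r k • y))) atTop
      (𝓝 (∫ y in Metric.ball (0 : Fin N → ℝ) 1, h y * ∫ ξ, φ ξ ∂(κ x₀))) := by
  set B := Metric.ball (0 : Fin N → ℝ) 1 with hB
  let Φ : ℕ → C(K, ℝ) := TopologicalSpace.denseSeq C(K, ℝ)
  have : Fact ((1 : ℝ≥0∞) ≠ ∞) := ⟨ENNReal.one_ne_top⟩
  let H : ℕ → Lp ℝ 1 (volume.restrict B) := TopologicalSpace.denseSeq _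
  have hHi : ∀ n, Integrable (H n) (volume.restrict B) := fun n =>
    memLp_one_iff_integrable.1 (Lp.memLp (H n))
  have hleb : ∀ᵐ x₀ ∂(volume.restrict Ω), ∀ m, ∀ h : (Fin N → ℝ) → ℝ,
      Integrable h (volume.restrict B) →
      Tendsto (fun r : ℝ => ∫ y in B, h y * ∫ ξ, Φ m ξ ∂(κ (x₀ + r • y))) (𝓝[>] 0)
        (𝓝 (∫ y in B, h y * ∫ ξ, Φ m ξ ∂(κ x₀))) := by
    rw [ae_all_iff]
    intro m
    exact ae_restrict_of_ae (ym_lebesgue _ (ym_meas κ (Φ m)) (norm_nonneg (Φ m)) (ym_bound κ (Φ m)))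
  filter_upwards [hleb, ae_restrict_mem hΩ.measurableSet] with x₀ hx₀ hx₀Ω
  let f : ℝ → ℕ → (ℕ × ℕ → ℝ) := fun r j p => ∫ y in B, H p.1 y * Φ p.2 (z j (x₀ + r • y))
  let S : Set (ℕ × ℕ → ℝ) := {v | ∃ r j, 0 < r ∧ v = f r j}
  have hsmall : ∀ᶠ r in 𝓝[>] (0 : ℝ), 0 < r ∧ ∀ y ∈ B, x₀ + r • y ∈ Ω := by
    obtain ⟨ε, hε, hεΩ⟩ := Metric.isOpen_iff.1 hΩ x₀ hx₀Ω
    filter_upwards [Ioo_mem_nhdsGT hε] with r hr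
    refine ⟨hr.1, fun y hy => hεΩ ?_⟩
    have hy : ‖y‖ < 1 := by simpa [hB] using hy
    rw [Metric.mem_ball, dist_eq_norm, add_sub_cancel_left, norm_smul, Real.norm_of_nonneg hr.1.le]
    nlinarith [hr.1, hr.2]
  have hcl : (fun p : ℕ × ℕ => ∫ y in B, H p.1 y * ∫ ξ, Φ p.2 ξ ∂(κ x₀)) ∈ closure S := by
    refine isClosed_closure.mem_of_tendsto (b := 𝓝[>] (0 : ℝ))
      (f := fun r p => ∫ y in B, H p.1 y * ∫ ξ, Φ p.2 ξ ∂(κ (x₀ + r • y))) ?_ ?_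
    · rw [tendsto_pi_nhds]
      exact fun p => hx₀ p.2 _ (hHi p.1)
    · filter_upwards [hsmall] with r hr
      refine mem_closure_of_tendsto (b := atTop) (f := fun j => f r j) ?_
        (Eventually.of_forall fun j => ⟨r, j, hr.1, rfl⟩)
      rw [tendsto_pi_nhds]
      exact fun p => ym_rescale hΩ hc x₀ hr.1 hr.2 _ (hHi p.1) (Φ p.2)
  obtain ⟨s, hs, hslim⟩ := mem_closure_iff_seq_limit.1 hcl
  choose r J hr hsJ using hs
  refine ⟨r, J, hr, ?_⟩
  rw [tendsto_pi_nhds] at hslim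
  have hzm : ∀ k, Measurable fun y => z (J k) (x₀ + r k • y) := fun k => (hz _).comp (by fun_prop)
  have step : ∀ m, ∀ h : (Fin N → ℝ) → ℝ, Integrable h (volume.restrict B) →
      Tendsto (fun k => ∫ y in B, h y * Φ m (z (J k) (x₀ + r k • y))) atTop
      (𝓝 (∫ y in B, h y * ∫ ξ, Φ m ξ ∂(κ x₀))) := by
    intro m h hh
    refine ym_L1_approx (norm_nonneg (Φ m)) hh (Eventually.of_forall fun k =>
      ((Φ m).continuous.measurable.comp (hzm k)).aestronglyMeasurable) aestronglyMeasurable_const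
      (fun k y => (Φ m).norm_coe_le_norm _) (fun _ => ym_bound κ (Φ m) _) fun ε hε => ?_
    obtain ⟨n, hn⟩ := (TopologicalSpace.denseRange_denseSeq (Lp ℝ 1 (volume.restrict B))).exists_dist_lt
      (hh.toL1 h) hε
    refine ⟨H n, hHi n, ?_, ?_⟩
    · have e1 : H n = (hHi n).toL1 (H n) := (Integrable.toL1_coeFn (H n) (hHi n)).symm
      have e2 : dist (hh.toL1 h) (H n) < ε := hn
      rw [e1, dist_eq_norm, ← Integrable.toL1_sub, L1.norm_of_fun_eq_integral_norm] at e2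
      exact e2.le
    · have := hslim (n, m)
      simp only [hsJ] at this
      exact this
  intro h hh φ
  refine ym_tendsto_of_approx fun ε hε => ?_
  set I := ∫ y in B, ‖h y‖ with hI
  have hI0 : 0 ≤ I := integral_nonneg fun _ => norm_nonneg _
  obtain ⟨m, hm⟩ := (TopologicalSpace.denseRange_denseSeq C(K, ℝ)).exists_dist_lt φ
    (show 0 < ε / (I + 1) by positivity)
  have hm : dist φ (Φ m) < ε / (I + 1) := hm
  have key : ∀ a b : (Fin N → ℝ) → ℝ, Measurable a → Measurable b → (∀ y, |a y| ≤ ‖φ‖) →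
      (∀ y, |b y| ≤ ‖Φ m‖) → (∀ y, |a y - b y| ≤ dist φ (Φ m)) →
      |(∫ y in B, h y * a y) - ∫ y in B, h y * b y| ≤ ε := by
    intro a b ha hb haM hbM hab
    have i1 : Integrable (fun y => h y * a y) (volume.restrict B) :=
      hh.mul_bdd (c := ‖φ‖) ha.aestronglyMeasurable (Eventually.of_forall haM)
    have i2 : Integrable (fun y => h y * b y) (volume.restrict B) :=
      hh.mul_bdd (c := ‖Φ m‖) hb.aestronglyMeasurable (Eventually.of_forall hbM)
    rw [← integral_sub i1 i2]
    calc _ ≤ ∫ y in B, |h y * a y - h y * b y| := abs_integral_le_integral_abs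
      _ ≤ ∫ y in B, ‖h y‖ * (ε / (I + 1)) := by
        refine integral_mono (i1.sub i2).abs (hh.norm.mul_const _) fun y => ?_
        simp only
        rw [← mul_sub, abs_mul]
        exact mul_le_mul_of_nonneg_left ((hab y).trans hm.le) (abs_nonneg _)
      _ ≤ ε := by
        rw [integral_mul_const, ← hI, mul_div_assoc', div_le_iff₀ (by positivity)]
        nlinarith
  refine ⟨_, _, step m h hh, Eventually.of_forall fun k => ?_, ?_⟩
  · exact key _ _ (φ.continuous.measurable.comp (hzm k)) ((Φ m).continuous.measurable.comp (hzm k))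
      (fun y => φ.norm_coe_le_norm _) (fun y => (Φ m).norm_coe_le_norm _)
      (fun y => ContinuousMap.dist_apply_le_dist (f := φ) (g := Φ m) (z (J k) (x₀ + r k • y)))
  · refine key (fun _ => ∫ ξ, φ ξ ∂(κ x₀)) (fun _ => ∫ ξ, Φ m ξ ∂(κ x₀)) measurable_const measurable_const (fun y => ym_bound κ φ _)
      (fun y => ym_bound κ (Φ m) _) (fun y => ?_)
    have hi : ∀ ψ : C(K, ℝ), Integrable ψ (κ x₀) := fun ψ =>
      Integrable.of_bound ψ.continuous.measurable.aestronglyMeasurable ‖ψ‖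
          (Eventually.of_forall fun y => ψ.norm_coe_le_norm _)
    rw [← integral_sub (hi _) (hi _), dist_eq_norm]
    exact ym_bound κ (φ - Φ m) x₀

lemma gm_measurable {N d : ℕ} (u : (Fin N → ℝ) → (Fin d → ℝ)) : Measurable fun x => gradMatrix u x := by
  refine measurable_pi_lambda _ fun i => measurable_pi_lambda _ fun k => ?_
  exact (measurable_pi_apply i).comp (measurable_fderiv_apply_const ℝ u (Pi.single k 1))

lemma gm_bound {N d : ℕ} {u : (Fin N → ℝ) → (Fin d → ℝ)} {C : ℝ≥0} (hu : LipschitzWith C u)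
    (x : Fin N → ℝ) : ‖gradMatrix u x‖ ≤ C := by
  refine (pi_norm_le_iff_of_nonneg C.2).2 fun i => (pi_norm_le_iff_of_nonneg C.2).2 fun k => ?_
  calc ‖gradMatrix u x i k‖ ≤ ‖fderiv ℝ u x (Pi.single k 1)‖ := norm_le_pi_norm _ i
    _ ≤ ‖fderiv ℝ u x‖ * ‖(Pi.single k 1 : Fin N → ℝ)‖ := ContinuousLinearMap.le_opNorm _ _
    _ ≤ C * 1 := by
      refine mul_le_mul (norm_fderiv_le_of_lipschitz ℝ hu) ?_ (norm_nonneg _) C.2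
      rw [Pi.norm_single]; simp
    _ = C := mul_one _

/-- Componentwise truncation at level `C`. -/
def ymClamp {d : ℕ} (C : ℝ) (v : Fin d → ℝ) : Fin d → ℝ := fun i => max (-C) (min C (v i))

lemma ymClamp_lip {d : ℕ} (C : ℝ) : LipschitzWith 1 (ymClamp (d := d) C) := by
  refine LipschitzWith.of_dist_le_mul fun v w => ?_
  rw [NNReal.coe_one, one_mul]
  refine (dist_pi_le_iff dist_nonneg).2 fun i => ?_
  refine le_trans ?_ (dist_le_pi_dist v w i)
  simp only [ymClamp, Real.dist_eq]
  calc _ ≤ |min C (v i) - min C (w i)| := by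
        simpa using abs_max_sub_max_le_max (-C) (min C (v i)) (-C) (min C (w i))
    _ ≤ _ := by
        simpa using abs_min_sub_min_le_max C (v i) C (w i)

lemma ymClamp_norm {d : ℕ} {C : ℝ} (hC : 0 ≤ C) (v : Fin d → ℝ) : ‖ymClamp C v‖ ≤ C := by
  refine (pi_norm_le_iff_of_nonneg hC).2 fun i => ?_
  rw [Real.norm_eq_abs, abs_le]
  exact ⟨le_max_left _ _, max_le (by linarith) (min_le_left _ _)⟩

lemma ymClamp_eq {d : ℕ} {C : ℝ} {v : Fin d → ℝ} (hv : ‖v‖ ≤ C) : ymClamp C v = v := by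
  ext i
  have := (norm_le_pi_norm v i).trans hv
  rw [Real.norm_eq_abs, abs_le] at this
  simp [ymClamp, this.1, this.2]

lemma ym_rescaled_fn {N d : ℕ} {u : (Fin N → ℝ) → (Fin d → ℝ)} {C : ℝ≥0} (hu : LipschitzWith C u)
    (x₀ : Fin N → ℝ) {r : ℝ} (hr : 0 < r) :
    ∃ v : (Fin N → ℝ) → (Fin d → ℝ), LipschitzWith C v ∧ (∀ x, ‖v x‖ ≤ C) ∧
      ∀ y ∈ Metric.ball (0 : Fin N → ℝ) 1, gradMatrix v y = gradMatrix u (x₀ + r • y) := by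
  let w : (Fin N → ℝ) → (Fin d → ℝ) := fun y => r⁻¹ • (u (x₀ + r • y) - u x₀)
  have hw : LipschitzWith C w := by
    refine LipschitzWith.of_dist_le_mul fun a b => ?_
    have h1 := hu.dist_le_mul (x₀ + r • a) (x₀ + r • b)
    simp only [w, dist_eq_norm] at h1 ⊢
    rw [← smul_sub, norm_smul, norm_inv, Real.norm_of_nonneg hr.le, sub_sub_sub_cancel_right]
    rw [add_sub_add_left_eq_sub, ← smul_sub, norm_smul, Real.norm_of_nonneg hr.le] at h1
    rw [inv_mul_le_iff₀ hr]
    linarith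
  have hw0 : w 0 = 0 := by simp [w]
  refine ⟨fun y => ymClamp C (w y), by
    have h := (ymClamp_lip (d := d) (C : ℝ)).comp hw
    rw [one_mul] at h
    exact h, fun x => ymClamp_norm C.2 _, ?_⟩
  intro y hy
  have heq : (fun y => ymClamp C (w y)) =ᶠ[𝓝 y] w := by
    filter_upwards [Metric.isOpen_ball.mem_nhds hy] with y' hy'
    apply ymClamp_eq
    have h1 := hw.dist_le_mul y' 0
    rw [hw0, dist_zero_right, dist_zero_right] at h1
    have h2 : ‖y'‖ < 1 := by simpa using hy'
    have := C.2
    exact h1.trans (mul_le_of_le_one_right C.2 h2.le)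
  ext i k
  simp only [gradMatrix]
  rw [heq.fderiv_eq]
  have h3 : fderiv ℝ w y = fderiv ℝ u (x₀ + r • y) := by
    let g : (Fin N → ℝ) → (Fin d → ℝ) := fun y' => u (x₀ + y') - u x₀
    have e1 : w = r⁻¹ • (fun y => g (r • y)) := rfl
    have e2 : fderiv ℝ (fun y => g (r • y)) y = r • fderiv ℝ g (r • y) := fderiv_comp_smul (𝕜 := ℝ) r
    have e3 : fderiv ℝ g (r • y) = fderiv ℝ u (x₀ + r • y) := by
      simp only [g]
      rw [fderiv_sub_const, fderiv_comp_add_left]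
    rw [e1, fderiv_const_smul_field, Pi.smul_apply, e2, e3, smul_smul, inv_mul_cancel₀ hr.ne', one_smul]
  rw [h3]

/-- Gradient of `u` as a map into a compact ball. -/
def ymGrad {N d : ℕ} {u : (Fin N → ℝ) → (Fin d → ℝ)} {C : ℝ≥0} (hu : LipschitzWith C u)
    (x : Fin N → ℝ) : Metric.closedBall (0 : Fin d → Fin N → ℝ) C :=
  ⟨gradMatrix u x, by simpa using gm_bound hu x⟩

lemma ymGrad_measurable {N d : ℕ} {u : (Fin N → ℝ) → (Fin d → ℝ)} {C : ℝ≥0}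
    (hu : LipschitzWith C u) : Measurable (ymGrad hu) :=
  (gm_measurable u).subtype_mk

open ProbabilityTheory in
lemma ym_homogeneous {N d : ℕ} {Ω : Set (Fin N → ℝ)} (hΩ : IsOpen Ω)
    {u : ℕ → (Fin N → ℝ) → (Fin d → ℝ)} {C : ℝ≥0} (hu : ∀ j, LipschitzWith C (u j))
    {κ : Kernel (Fin N → ℝ) (Metric.closedBall (0 : Fin d → Fin N → ℝ) C)} [IsMarkovKernel κ]
    (hc : YMConv (volume.restrict Ω) (fun j => ymGrad (hu j)) κ) :
    ∀ᵐ x₀ ∂(volume.restrict Ω), IsHomogeneousGradientYM ((κ x₀).map Subtype.val) := by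
  filter_upwards [ym_blowup hΩ (fun j => ymGrad_measurable (hu j)) hc] with x₀ hx₀
  obtain ⟨r, J, hr, hlim⟩ := hx₀
  have hprob : IsProbabilityMeasure ((κ x₀).map Subtype.val) :=
    Measure.isProbabilityMeasure_map measurable_subtype_coe.aemeasurable
  refine ⟨hprob, Metric.ball 0 1, Metric.isOpen_ball, ⟨0, by simp⟩, Metric.isBounded_ball, ?_⟩
  choose v hv1 hv2 hv3 using fun k => ym_rescaled_fn (hu (J k)) x₀ (hr k)
  refine ⟨v, ⟨C, fun j => ⟨hv1 j, hv2 j⟩⟩, fun j => gm_measurable (v j),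
    ⟨Eventually.of_forall fun _ => hprob, fun φ => measurable_const⟩, fun h hh φ => ?_⟩
  let ψ : C(Metric.closedBall (0 : Fin d → Fin N → ℝ) C, ℝ) :=
    ⟨fun ξ => φ ξ, (map_continuous φ).comp continuous_subtype_val⟩
  have h1 := hlim h hh ψ
  have h2 : ∫ ξ, φ ξ ∂((κ x₀).map Subtype.val) = ∫ ξ, ψ ξ ∂(κ x₀) := by
    rw [integral_map measurable_subtype_coe.aemeasurable (map_continuous φ).measurable.aestronglyMeasurable]
    rfl
  simp only [h2]
  refine h1.congr fun k => ?_
  refine setIntegral_congr_fun measurableSet_ball fun y hy => ?_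
  show h y * φ (gradMatrix (u (J k)) (x₀ + r k • y)) = _
  rw [← hv3 k y hy]

open ProbabilityTheory in
lemma ym_barycenter {N d : ℕ} {Ω : Set (Fin N → ℝ)} [IsFiniteMeasure (volume.restrict Ω)]
    {u : ℕ → (Fin N → ℝ) → (Fin d → ℝ)} {C : ℝ≥0} (hu : ∀ j, LipschitzWith C (u j))
    {u₀ : (Fin N → ℝ) → (Fin d → ℝ)} {L : ℝ≥0} (hu₀ : LipschitzWith L u₀)
    {κ : Kernel (Fin N → ℝ) (Metric.closedBall (0 : Fin d → Fin N → ℝ) C)} [IsMarkovKernel κ]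
    (hc : YMConv (volume.restrict Ω) (fun j => ymGrad (hu j)) κ)
    (hw : ∀ h : (Fin N → ℝ) → ℝ, Integrable h (volume.restrict Ω) → ∀ (i : Fin d) (k : Fin N),
      Tendsto (fun j => ∫ x in Ω, h x * gradMatrix (u j) x i k) atTop
      (𝓝 (∫ x in Ω, h x * gradMatrix u₀ x i k))) :
    ∀ᵐ x₀ ∂(volume.restrict Ω), ∫ ξ, ξ ∂((κ x₀).map Subtype.val) = gradMatrix u₀ x₀ := by
  let π : Fin d → Fin N → C(Metric.closedBall (0 : Fin d → Fin N → ℝ) C, ℝ) := fun i k =>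
    ⟨fun ξ => (ξ : Fin d → Fin N → ℝ) i k, (continuous_apply k).comp ((continuous_apply i).comp continuous_subtype_val)⟩
  have hall : ∀ᵐ x₀ ∂(volume.restrict Ω), ∀ i k, ∫ ξ, π i k ξ ∂(κ x₀) = gradMatrix u₀ x₀ i k := by
    rw [ae_all_iff]; intro i
    rw [ae_all_iff]; intro k
    have hm0 : Measurable fun x => gradMatrix u₀ x i k :=
      (measurable_pi_apply k).comp ((measurable_pi_apply i).comp (gm_measurable u₀))
    have i1 : Integrable (fun x => ∫ ξ, π i k ξ ∂(κ x)) (volume.restrict Ω) :=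
      Integrable.of_bound (ym_meas κ (π i k)).aestronglyMeasurable ‖π i k‖
        (Eventually.of_forall (ym_bound κ (π i k)))
    have i2 : Integrable (fun x => gradMatrix u₀ x i k) (volume.restrict Ω) :=
      Integrable.of_bound hm0.aestronglyMeasurable L (Eventually.of_forall fun x =>
        (norm_le_pi_norm (gradMatrix u₀ x i) k).trans ((norm_le_pi_norm (gradMatrix u₀ x) i).trans (gm_bound hu₀ x)))
    refine Integrable.ae_eq_of_forall_setIntegral_eq _ _ i1 i2 fun s hs _ => ?_
    have hI : Integrable (s.indicator fun _ => (1 : ℝ)) (volume.restrict Ω) :=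
      (integrable_const 1).indicator hs
    have e := tendsto_nhds_unique (hc _ hI (π i k)) (hw _ hI i k)
    have e2 : ∀ f : (Fin N → ℝ) → ℝ, ∫ x in Ω, s.indicator (fun _ => (1 : ℝ)) x * f x =
        ∫ x in s, f x ∂(volume.restrict Ω) := by
      intro f
      rw [← integral_indicator hs]
      congr 1
      ext x
      by_cases hx : x ∈ s <;> simp [hx]
    rwa [e2, e2] at e
  filter_upwards [hall] with x₀ hx₀
  have e := integral_map (μ := κ x₀) (φ := Subtype.val) measurable_subtype_coe.aemeasurable
    (f := fun ξ : Fin d → Fin N → ℝ => ξ) aestronglyMeasurable_id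
  rw [e]
  have hIntg : Integrable (fun ξ : Metric.closedBall (0 : Fin d → Fin N → ℝ) C => (ξ : Fin d → Fin N → ℝ)) (κ x₀) :=
    Integrable.of_bound measurable_subtype_coe.aestronglyMeasurable C (Eventually.of_forall fun ξ => 
      mem_closedBall_zero_iff.1 ξ.2)
  ext i k
  rw [← hx₀ i k]
  have := ((ContinuousLinearMap.proj (R := ℝ) (φ := fun _ : Fin N => ℝ) k).comp
    (ContinuousLinearMap.proj (R := ℝ) (φ := fun _ : Fin d => Fin N → ℝ) i)).integral_comp_comm hIntg
  exact this.symm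

/-- **Theorem (lower semicontinuity of nonlocal supremal functionals).**
Let `Ω ⊂ ℝ^N` be a bounded open set and let `W : Ω × Ω × ℝ^{d×N} × ℝ^{d×N} → ℝ` be a normal
integrand, bounded from below, such that `W(x,y,·,·)` is separately curl Young quasiconvex for
a.e. `(x,y) ∈ Ω × Ω`.  Then `F(u) = esssup_{(x,y) ∈ Ω×Ω} W(x,y,∇u(x),∇u(y))` is sequentially
weakly* lower semicontinuous on `W^{1,∞}(Ω;ℝ^d)`. -/
theorem lsc_nonlocal_supremal_gradient {N d : ℕ}
    (Ω : Set (Fin N → ℝ)) (hΩo : IsOpen Ω) (hΩb : IsBounded Ω)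
    (W : (Fin N → ℝ) → (Fin N → ℝ) → (Fin d → Fin N → ℝ) → (Fin d → Fin N → ℝ) → ℝ)
    (hWmeas : Measurable fun p :
        ((Fin N → ℝ) × (Fin N → ℝ)) × (Fin d → Fin N → ℝ) × (Fin d → Fin N → ℝ) =>
      W p.1.1 p.1.2 p.2.1 p.2.2)
    (hWlsc : ∀ᵐ p ∂((volume.restrict Ω).prod (volume.restrict Ω)),
      LowerSemicontinuous fun q : (Fin d → Fin N → ℝ) × (Fin d → Fin N → ℝ) =>
        W p.1 p.2 q.1 q.2)
    (hWbdd : ∃ c : ℝ, ∀ x y ξ ζ, c ≤ W x y ξ ζ)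
    (hWqcx : ∀ᵐ p ∂((volume.restrict Ω).prod (volume.restrict Ω)),
      SeparatelyCurlYoungQuasiconvex (W p.1 p.2))
    (F : ((Fin N → ℝ) → (Fin d → ℝ)) → EReal)
    (hF : ∀ u, F u = essSup (fun p : (Fin N → ℝ) × (Fin N → ℝ) =>
        (W p.1 p.2 (gradMatrix u p.1) (gradMatrix u p.2) : EReal))
      ((volume.restrict Ω).prod (volume.restrict Ω)))
    (u : ℕ → (Fin N → ℝ) → (Fin d → ℝ)) (u₀ : (Fin N → ℝ) → (Fin d → ℝ))
    (hu₀ : ∃ L : ℝ≥0, LipschitzWith L u₀)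
    (hconv : WeakStarConvW1inf Ω u u₀) :
    F u₀ ≤ liminf (fun j => F (u j)) atTop := by
  rcases eq_or_ne (volume.restrict Ω) 0 with h0 | h0
  · rw [hF, h0]
    simp
  have hfin : IsFiniteMeasure (volume.restrict Ω) := ⟨by
    rw [Measure.restrict_apply_univ]; exact hΩb.measure_lt_top⟩
  refine le_of_forall_gt_imp_ge_of_dense fun c hc => ?_
  induction c with
  | bot => exact absurd hc not_lt_bot
  | top => exact le_top
  | coe c =>
  obtain ⟨θ, hθ, hθc⟩ := extraction_of_frequently_atTop (frequently_lt_of_liminf_lt (by isBoundedDefault) hc)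
  obtain ⟨⟨C, hC⟩, hw⟩ := hconv
  obtain ⟨L, hL⟩ := hu₀
  have hne : Nonempty (Metric.closedBall (0 : Fin d → Fin N → ℝ) C) := ⟨⟨0, by simp⟩⟩
  have : CompactSpace (Metric.closedBall (0 : Fin d → Fin N → ℝ) C) :=
    isCompact_iff_compactSpace.1 (isCompact_closedBall _ _)
  obtain ⟨η, hη, κ, hκ, hcv⟩ := ym_exists (volume.restrict Ω) h0
    (fun j => ymGrad (hC (θ j)).1) (fun j => ymGrad_measurable _)
  have hlip : ∀ j, LipschitzWith C (u (θ (η j))) := fun j => (hC _).1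
  have hcv : YMConv (volume.restrict Ω) (fun j => ymGrad (hlip j)) κ := hcv
  have hhom := ym_homogeneous hΩo hlip hcv
  have hbar := ym_barycenter hlip hL hcv (fun h hh i k =>
    ((hw h hh).2 i k).comp (hθ.comp hη).tendsto_atTop)
  have hsupp := ym_support (fun j => ymGrad_measurable (hlip j)) hcv
    (fun p => {q | c < W p.1 p.2 q.1 q.2}) (by
      filter_upwards [hWlsc] with p hp
      exact (hp.isOpen_preimage c).preimage (by fun_prop :
        Continuous fun q : Metric.closedBall (0 : Fin d → Fin N → ℝ) C ×
          Metric.closedBall (0 : Fin d → Fin N → ℝ) C =>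
          ((q.1 : Fin d → Fin N → ℝ), (q.2 : Fin d → Fin N → ℝ)))) (by
      intro j
      have h1 := hθc (η j)
      rw [hF] at h1
      filter_upwards [ae_lt_of_essSup_lt h1] with p hp
      have hp' := EReal.coe_lt_coe_iff.1 hp
      intro hcon
      exact absurd hp' (not_lt.2 (le_of_lt hcon)))
  rw [hF]
  refine essSup_le_of_ae_le _ ?_
  filter_upwards [hsupp, hWqcx, Measure.quasiMeasurePreserving_fst.ae hhom,
    Measure.quasiMeasurePreserving_snd.ae hhom, Measure.quasiMeasurePreserving_fst.ae hbar,
    Measure.quasiMeasurePreserving_snd.ae hbar] with p hs hq h1 h2 b1 b2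
  have hfinal := hq _ _ h1 h2
  rw [b1, b2] at hfinal
  refine hfinal.trans ?_
  have hemb : MeasurableEmbedding (Subtype.val : Metric.closedBall (0 : Fin d → Fin N → ℝ) C → _) :=
    MeasurableEmbedding.subtype_coe measurableSet_closedBall
  have hae := Measure.ae_ae_of_ae_prod (measure_eq_zero_iff_ae_notMem.1 hs)
  refine essSup_le_of_ae_le _ ?_
  rw [EventuallyLE, hemb.ae_map_iff]
  filter_upwards [hae] with ξ hξ
  refine essSup_le_of_ae_le _ ?_
  rw [EventuallyLE, hemb.ae_map_iff]
  filter_upwards [hξ] with ζ hζ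
  exact EReal.coe_le_coe_iff.2 (not_lt.1 hζ)

end
end

section
/- Let Q = (0,1)^N and let f : ℝ^{d×N} → ℝ be a lower semicontinuous function bounded from below. Then the following are equivalent: (i) f is curl Young quasiconvex, i.e., for every W^{1,∞}-gradient Young measure ν = {ν_x}_{x∈Q} on Q one has f( ∫_{ℝ^{d×N}} ξ dν_x(ξ) ) ≤ esssup_{y∈Q} ( ν_y-esssup_{ξ∈ℝ^{d×N}} f(ξ) ) for L^N-a.e. x ∈ Q; (ii) for every homogeneous W^{1,∞}-gradient Young measure ν one has f( ∫_{ℝ^{d×N}} ξ dν(ξ) ) ≤ ν-esssup_{ξ∈ℝ^{d×N}} f(ξ). -/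
open MeasureTheory Filter Topology Bornology ZeroAtInfty NNReal ENNReal

noncomputable section

/-- The open unit cube `Q = (0,1)^N` in `ℝ^N`. -/
def unitCube (N : ℕ) : Set (Fin N → ℝ) := Set.pi Set.univ fun _ => Set.Ioo (0 : ℝ) 1

lemma gradMatrix_measurable {N d : ℕ} (u : (Fin N → ℝ) → (Fin d → ℝ)) :
    Measurable (fun x => gradMatrix u x) := by
  refine measurable_pi_iff.2 fun i => measurable_pi_iff.2 fun j => ?_
  exact (measurable_pi_apply i).comp (measurable_fderiv_apply_const ℝ u (Pi.single j 1))

/-- Blow-up of a Lipschitz function, truncated so as to be globally bounded. -/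
lemma exists_blowup {N d : ℕ} (u : (Fin N → ℝ) → (Fin d → ℝ)) (C : ℝ≥0) (hu : LipschitzWith C u)
    (a : Fin N → ℝ) (r : ℝ) (hr : 0 < r) :
    ∃ w : (Fin N → ℝ) → (Fin d → ℝ), LipschitzWith C w ∧ (∀ x, ‖w x‖ ≤ C) ∧
      ∀ y ∈ Metric.ball (0 : Fin N → ℝ) 1, gradMatrix w y = gradMatrix u (a + r • y) := by
  have hC : (-(C : ℝ)) ≤ C := by linarith [C.2, show (0 : ℝ) ≤ C from C.2]
  let v : (Fin N → ℝ) → (Fin d → ℝ) := fun y => r⁻¹ • (u (a + r • y) - u a)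
  have hv : LipschitzWith C v := by
    refine LipschitzWith.of_dist_le_mul fun y z => ?_
    have h1 := hu.dist_le_mul (a + r • y) (a + r • z)
    have h2 : dist (a + r • y) (a + r • z) = r * dist y z := by
      rw [dist_add_left, dist_smul₀, Real.norm_of_nonneg hr.le]
    rw [h2] at h1
    have h3 : dist (v y) (v z) = r⁻¹ * dist (u (a + r • y)) (u (a + r • z)) := by
      simp only [v]
      rw [dist_smul₀, dist_sub_right, Real.norm_of_nonneg (by positivity)]
    rw [h3]
    calc r⁻¹ * dist (u (a + r • y)) (u (a + r • z)) ≤ r⁻¹ * (C * (r * dist y z)) := by gcongr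
      _ = C * dist y z := by field_simp
  have hv0 : v 0 = 0 := by simp [v]
  have hvb : ∀ y ∈ Metric.ball (0 : Fin N → ℝ) 1, ‖v y‖ ≤ C := by
    intro y hy
    have := hv.dist_le_mul y 0
    rw [hv0, dist_zero_right] at this
    have hy' : dist y 0 ≤ 1 := (Metric.mem_ball.1 hy).le
    calc ‖v y‖ ≤ C * dist y 0 := this
      _ ≤ C * 1 := by gcongr
      _ = C := mul_one _
  let w : (Fin N → ℝ) → (Fin d → ℝ) := fun y i => (Set.projIcc (-(C : ℝ)) C hC (v y i) : ℝ)
  refine ⟨w, ?_, ?_, ?_⟩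
  · refine LipschitzWith.of_dist_le_mul fun y z => ?_
    refine (dist_pi_le_iff (by positivity)).2 fun i => ?_
    have h1 := (LipschitzWith.projIcc hC).dist_le_mul (v y i) (v z i)
    simp only [NNReal.coe_one, one_mul] at h1
    calc dist (w y i) (w z i) ≤ dist (v y i) (v z i) := h1
      _ ≤ dist (v y) (v z) := dist_le_pi_dist _ _ i
      _ ≤ _ := hv.dist_le_mul y z
  · intro x
    refine (pi_norm_le_iff_of_nonneg C.2).2 fun i => ?_
    rw [Real.norm_eq_abs, abs_le]
    exact (Set.projIcc (-(C : ℝ)) C hC (v x i)).2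
  · intro y hy
    have hEq : w =ᶠ[𝓝 y] v := by
      filter_upwards [Metric.isOpen_ball.mem_nhds hy] with z hz
      funext i
      have h1 : ‖v z i‖ ≤ C := (norm_le_pi_norm (v z) i).trans (hvb z hz)
      rw [Real.norm_eq_abs, abs_le] at h1
      simp only [w]
      rw [Set.projIcc_of_mem hC h1]
    have h2 : fderiv ℝ w y = fderiv ℝ u (a + r • y) := by
      rw [hEq.fderiv_eq]
      have e1 : v = r⁻¹ • (fun y => u (a + r • y) - u a) := rfl
      rw [e1, fderiv_const_smul_field, Pi.smul_apply, fderiv_sub_const,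
        fderiv_comp_smul (f := fun x => u (a + x)), fderiv_comp_add_left, smul_smul,
        inv_mul_cancel₀ hr.ne', one_smul]
    unfold gradMatrix
    rw [h2]

lemma chg_var {N : ℕ} (S Ω : Set (Fin N → ℝ)) (hS : MeasurableSet S) (a : Fin N → ℝ) (r : ℝ)
    (hr : 0 < r) (hSΩ : ∀ y ∈ S, a + r • y ∈ Ω) (h G : (Fin N → ℝ) → ℝ) :
    ∫ y in S, h y * G (a + r • y) =
      (r ^ N)⁻¹ * ∫ x in Ω, S.indicator h (r⁻¹ • (-a + x)) * G x := by
  let F : (Fin N → ℝ) → ℝ := fun x => S.indicator h (r⁻¹ • (-a + x)) * G x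
  have h1 : ∫ x in Ω, F x = ∫ x, F x := by
    apply setIntegral_eq_integral_of_forall_compl_eq_zero
    intro x hx
    have : r⁻¹ • (-a + x) ∉ S := by
      intro hs
      have := hSΩ _ hs
      rw [smul_smul, mul_inv_cancel₀ hr.ne', one_smul, add_neg_cancel_left] at this
      exact hx this
    simp only [F, Set.indicator_of_notMem this, zero_mul]
  have h2 : ∫ y in S, h y * G (a + r • y) = ∫ y, F (a + r • y) := by
    rw [← integral_indicator hS]
    congr 1
    funext y
    simp only [F]
    rw [neg_add_cancel_left, smul_smul, inv_mul_cancel₀ hr.ne', one_smul]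
    by_cases hy : y ∈ S <;> simp [hy]
  have h3 := Measure.integral_comp_smul (volume : Measure (Fin N → ℝ)) (fun x => F (a + x)) r
  rw [h2, h3, integral_add_left_eq_self F a, ← h1, Module.finrank_fin_fun,
    abs_of_pos (by positivity), smul_eq_mul]

lemma tendsto_scale {N : ℕ} (S Ω : Set (Fin N → ℝ)) (hS : MeasurableSet S) (a : Fin N → ℝ)
    (r : ℝ) (hr : 0 < r) (hSΩ : ∀ y ∈ S, a + r • y ∈ Ω) (G : ℕ → (Fin N → ℝ) → ℝ)
    (g : (Fin N → ℝ) → ℝ)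
    (hG : ∀ h : (Fin N → ℝ) → ℝ, Integrable h (volume.restrict Ω) →
      Tendsto (fun j => ∫ x in Ω, h x * G j x) atTop (𝓝 (∫ x in Ω, h x * g x)))
    (h : (Fin N → ℝ) → ℝ) (hh : IntegrableOn h S) :
    Tendsto (fun j => ∫ y in S, h y * G j (a + r • y)) atTop
      (𝓝 (∫ y in S, h y * g (a + r • y))) := by
  have hi : Integrable (fun x => S.indicator h (r⁻¹ • (-a + x))) := by
    have h1 : Integrable (S.indicator h) := (integrable_indicator_iff hS).2 hh
    exact (h1.comp_smul (inv_ne_zero hr.ne')).comp_add_left (-a)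
  have := (hG _ (hi.mono_measure Measure.restrict_le_self)).const_mul (r ^ N)⁻¹
  rw [← chg_var S Ω hS a r hr hSΩ h g] at this
  refine this.congr fun j => ?_
  rw [← chg_var S Ω hS a r hr hSΩ h (G j)]

lemma tendsto_of_approx {a : ℕ → ℝ} {L : ℝ}
    (H : ∀ ε > 0, ∃ (b : ℕ → ℝ) (M : ℝ), Tendsto b atTop (𝓝 M) ∧ (∀ k, |a k - b k| ≤ ε) ∧
      |L - M| ≤ ε) : Tendsto a atTop (𝓝 L) := by
  rw [Metric.tendsto_atTop]
  intro ε hε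
  obtain ⟨b, M, hb, h1, h2⟩ := H (ε / 4) (by positivity)
  obtain ⟨n, hn⟩ := Metric.tendsto_atTop.1 hb (ε / 4) (by positivity)
  refine ⟨n, fun k hk => ?_⟩
  have h3 := hn k hk
  have h4 := h1 k
  rw [Real.dist_eq] at h3 ⊢
  rw [abs_le] at h2 h4
  rw [abs_lt] at h3 ⊢
  constructor <;> linarith [h2.1, h2.2, h3.1, h3.2, h4.1, h4.2]

/-- A sequence of continuous functions, dense for uniform convergence on compact sets. -/
lemma exists_dense_seq_cont (X : Type*) [TopologicalSpace X] [LocallyCompactSpace X]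
    [SecondCountableTopology X] :
    ∃ D : ℕ → C(X, ℝ), ∀ (f : C(X, ℝ)) (K : Set X), IsCompact K → ∀ ε > 0, ∃ n,
      ∀ x ∈ K, |f x - D n x| < ε := by
  obtain ⟨D, hD⟩ := TopologicalSpace.exists_dense_seq C(X, ℝ)
  refine ⟨D, fun f K hK ε hε => ?_⟩
  obtain ⟨s, hs, hsf⟩ := mem_closure_iff_seq_limit.1 (hD f)
  have h1 := ContinuousMap.tendsto_iff_forall_isCompact_tendstoUniformlyOn.1 hsf K hK
  obtain ⟨k, hk⟩ := (Metric.tendstoUniformlyOn_iff.1 h1 ε hε).exists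
  obtain ⟨n, hn⟩ := hs k
  refine ⟨n, fun x hx => ?_⟩
  have := hk x hx
  rwa [← hn, Real.dist_eq] at this

/-- `C₀` is separable. -/
lemma exists_dense_seq_zero (E : Type*) [NormedAddCommGroup E] [ProperSpace E] :
    ∃ Φ : ℕ → C₀(E, ℝ), ∀ (φ : C₀(E, ℝ)), ∀ ε > 0, ∃ n, ∀ x, |φ x - Φ n x| ≤ ε := by
  obtain ⟨D, hD⟩ := exists_dense_seq_cont E
  let χ : ℕ → E → ℝ := fun n x => max 0 (min 1 (n + 1 - ‖x‖))
  have hχc : ∀ n, Continuous (χ n) := fun n => by fun_prop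
  have hχ0 : ∀ n x, 0 ≤ χ n x := fun n x => le_max_left _ _
  have hχ1 : ∀ n x, χ n x ≤ 1 := fun n x => max_le zero_le_one (min_le_left _ _)
  have hχin : ∀ (n : ℕ) x, ‖x‖ ≤ n → χ n x = 1 := fun n x hx => by
    simp only [χ]
    rw [min_eq_left (by linarith), max_eq_right zero_le_one]
  have hχout : ∀ (n : ℕ) x, (n : ℝ) + 1 < ‖x‖ → χ n x = 0 := fun n x hx => by
    simp only [χ]
    exact max_eq_left ((min_le_right _ _).trans (by linarith))
  let Ψ : ℕ → ℕ → C₀(E, ℝ) := fun n l =>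
    { toFun := fun x => χ n x * D l x
      continuous_toFun := (hχc n).mul (D l).continuous
      zero_at_infty' := by
        apply HasCompactSupport.is_zero_at_infty
        refine HasCompactSupport.intro (isCompact_closedBall (0 : E) (n + 1)) fun x hx => ?_
        rw [Metric.mem_closedBall, dist_zero_right, not_le] at hx
        simp [hχout n x hx] }
  refine ⟨fun k => Ψ k.unpair.1 k.unpair.2, fun φ ε hε => ?_⟩
  have h1 : ∀ᶠ x in cocompact E, |φ x| < ε / 2 := by
    have := φ.zero_at_infty'.abs
    rw [abs_zero] at this
    exact this.eventually (gt_mem_nhds (by positivity))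
  obtain ⟨R, hR⟩ : ∃ R : ℝ, ∀ x : E, R < ‖x‖ → |φ x| < ε / 2 := by
    obtain ⟨K, hK, hKs⟩ := mem_cocompact.1 h1
    obtain ⟨R, hR⟩ := hK.isBounded.subset_closedBall (0 : E)
    refine ⟨R, fun x hx => hKs fun hxK => ?_⟩
    have := hR hxK
    rw [Metric.mem_closedBall, dist_zero_right] at this
    linarith
  obtain ⟨n, hn⟩ := exists_nat_ge R
  obtain ⟨l, hl⟩ := hD φ.toContinuousMap _ (isCompact_closedBall (0 : E) (n + 1)) (ε / 2)
    (by positivity)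
  refine ⟨Nat.pair n l, fun x => ?_⟩
  have e : Ψ (Nat.pair n l).unpair.1 (Nat.pair n l).unpair.2 x = χ n x * D l x := by
    rw [Nat.unpair_pair]; rfl
  rw [e]
  rcases lt_or_ge ((n : ℝ) + 1) ‖x‖ with hx | hx
  · rw [hχout n x hx, zero_mul, sub_zero]
    linarith [hR x (by linarith)]
  · have h2 : |φ x - D l x| < ε / 2 := hl x (by simpa using hx)
    have h3 : |(1 - χ n x) * φ x| ≤ ε / 2 := by
      rcases le_or_gt ‖x‖ n with hx' | hx'
      · rw [hχin n x hx']; simp; positivity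
      · rw [abs_mul, abs_of_nonneg (by linarith [hχ1 n x])]
        have := hR x (by linarith)
        nlinarith [hχ0 n x, hχ1 n x, abs_nonneg (φ x)]
    have h4 : |χ n x * (φ x - D l x)| ≤ ε / 2 := by
      rw [abs_mul, abs_of_nonneg (hχ0 n x)]
      nlinarith [hχ0 n x, hχ1 n x, abs_nonneg (φ x - D l x)]
    have h5 : φ x - χ n x * D l x = (1 - χ n x) * φ x + χ n x * (φ x - D l x) := by ring
    rw [h5]
    linarith [abs_add_le ((1 - χ n x) * φ x) (χ n x * (φ x - D l x))]

lemma abs_C0_le {E : Type*} [TopologicalSpace E] (φ : C₀(E, ℝ)) : ∃ M : ℝ, 0 ≤ M ∧ ∀ x, |φ x| ≤ M := by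
  refine ⟨‖φ.toBCF‖, norm_nonneg _, fun x => ?_⟩
  exact φ.toBCF.norm_coe_le_norm x

/-- Lebesgue points: blow-up limits. -/
lemma lebesgue_blowup {N : ℕ} (g : (Fin N → ℝ) → ℝ) (hg : Measurable g) (M : ℝ)
    (hM : ∀ x, |g x| ≤ M) :
    ∀ᵐ x : Fin N → ℝ, ∀ h : C(Fin N → ℝ, ℝ),
      Tendsto (fun r : ℝ => ∫ y in Metric.ball (0 : Fin N → ℝ) 1, h y * g (x + r • y))
        (𝓝[>] 0) (𝓝 (∫ y in Metric.ball (0 : Fin N → ℝ) 1, h y * g x)) := by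
  have hfin : ∀ (x : Fin N → ℝ) r, volume (Metric.closedBall x r) ≠ ∞ := fun x r =>
    (isCompact_closedBall x r).measure_lt_top.ne
  have hloc : LocallyIntegrable g := by
    have : LocallyIntegrable (fun _ : Fin N → ℝ => M) := locallyIntegrable_const M
    refine this.mono hg.aestronglyMeasurable (Eventually.of_forall fun x => ?_)
    rw [Real.norm_eq_abs, Real.norm_eq_abs]
    exact (hM x).trans (le_abs_self M)
  filter_upwards [IsUnifLocDoublingMeasure.ae_tendsto_average_norm_sub volume hloc 1] with x hx h
  have hx1 := hx (fun _ : ℝ => x) (fun r : ℝ => r) (tendsto_id : Tendsto id (𝓝[>] (0 : ℝ)) _)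
    (by
      filter_upwards [self_mem_nhdsWithin] with r hr
      exact Metric.mem_closedBall_self (by simpa using (le_of_lt hr)))
  obtain ⟨A, hA⟩ : ∃ A : ℝ, ∀ y ∈ Metric.closedBall (0 : Fin N → ℝ) 1, ‖h y‖ ≤ A :=
    (isCompact_closedBall (0 : Fin N → ℝ) 1).exists_bound_of_continuousOn h.continuous.continuousOn
  have hA0 : 0 ≤ A := (norm_nonneg _).trans (hA 0 (by simp))
  set V : ℝ := volume.real (Metric.ball (0 : Fin N → ℝ) 1) with hV
  rw [tendsto_iff_norm_sub_tendsto_zero]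
  have hlim : Tendsto (fun r : ℝ => A * (V * ⨍ y in Metric.closedBall x r, ‖g y - g x‖))
      (𝓝[>] 0) (𝓝 0) := by
    simpa using (hx1.const_mul V).const_mul A
  refine squeeze_zero' (Eventually.of_forall fun _ => norm_nonneg _) ?_ hlim
  filter_upwards [self_mem_nhdsWithin] with r hr
  have hr : 0 < r := hr
  have hgd : Measurable fun y => ‖g y - g x‖ := (hg.sub_const _).norm
  have hgb : ∀ y, ‖g y - g x‖ ≤ M + M := fun y =>
    (norm_sub_le _ _).trans (add_le_add (hM y) (hM x))
  have hmap : Measurable fun y : Fin N → ℝ => x + r • y := by fun_prop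
  have : IsFiniteMeasure (volume.restrict (Metric.ball (0 : Fin N → ℝ) 1)) :=
    ⟨by rw [Measure.restrict_apply_univ]; exact measure_ball_lt_top⟩
  have hbd : ∀ G : (Fin N → ℝ) → ℝ, Measurable G → ∀ B : ℝ, (∀ y, ‖G y‖ ≤ B) →
      Integrable (fun y => h y * G y) (volume.restrict (Metric.ball (0 : Fin N → ℝ) 1)) := by
    intro G hG B hB
    refine Integrable.of_bound (C := A * B)
      (h.continuous.measurable.mul hG).aestronglyMeasurable ?_
    filter_upwards [ae_restrict_mem measurableSet_ball] with y hy
    rw [norm_mul]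
    have := hA y (Metric.ball_subset_closedBall hy)
    have := hB y
    gcongr
  rw [← integral_sub (hbd (fun y => g (x + r • y)) (hg.comp hmap) M fun y => hM _)
    (hbd (fun _ => g x) measurable_const M fun y => hM _)]
  have step1 : ‖∫ y in Metric.ball (0 : Fin N → ℝ) 1, (h y * g (x + r • y) - h y * g x)‖ ≤
      ∫ y in Metric.ball (0 : Fin N → ℝ) 1, A * ‖g (x + r • y) - g x‖ := by
    refine norm_integral_le_of_norm_le ?_ ?_
    · refine Integrable.const_mul ?_ _
      refine Integrable.of_bound (C := M + M) (hgd.comp hmap).aestronglyMeasurable ?_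
      exact Eventually.of_forall fun y => by rw [norm_norm]; exact hgb _
    · filter_upwards [ae_restrict_mem measurableSet_ball] with y hy
      rw [← mul_sub, norm_mul]
      have := hA y (Metric.ball_subset_closedBall hy)
      gcongr
  refine step1.trans ?_
  rw [integral_const_mul]
  refine mul_le_mul_of_nonneg_left ?_ hA0
  have e1 := chg_var (Metric.closedBall (0 : Fin N → ℝ) 1) (Metric.closedBall x r)
    measurableSet_closedBall x r hr (fun y hy => by
      rw [Metric.mem_closedBall, dist_zero_right] at hy
      rw [Metric.mem_closedBall, dist_self_add_left, norm_smul, Real.norm_of_nonneg hr.le]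
      nlinarith) (fun _ => 1) (fun y => ‖g y - g x‖)
  simp only [one_mul] at e1
  have e2 : ∫ y in Metric.closedBall x r,
      (Metric.closedBall (0 : Fin N → ℝ) 1).indicator (fun _ => (1 : ℝ)) (r⁻¹ • (-x + y)) *
        ‖g y - g x‖ = ∫ y in Metric.closedBall x r, ‖g y - g x‖ := by
    refine setIntegral_congr_fun measurableSet_closedBall fun y hy => ?_
    have : r⁻¹ • (-x + y) ∈ Metric.closedBall (0 : Fin N → ℝ) 1 := by
      rw [Metric.mem_closedBall, dist_eq_norm, ← neg_add_eq_sub] at hy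
      rw [Metric.mem_closedBall, dist_zero_right, norm_smul, Real.norm_of_nonneg (by positivity)]
      rw [inv_mul_le_iff₀ hr]; linarith
    simp only [Set.indicator_of_mem this, one_mul]
  rw [e2] at e1
  have e3 : ∫ y in Metric.ball (0 : Fin N → ℝ) 1, ‖g (x + r • y) - g x‖ ≤
      ∫ y in Metric.closedBall (0 : Fin N → ℝ) 1, ‖g (x + r • y) - g x‖ := by
    refine setIntegral_mono_set ?_ (Eventually.of_forall fun _ => norm_nonneg _)
      (Metric.ball_subset_closedBall.eventuallyLE)
    have : IsFiniteMeasure (volume.restrict (Metric.closedBall (0 : Fin N → ℝ) 1)) :=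
      ⟨by rw [Measure.restrict_apply_univ]; exact (hfin _ _).lt_top⟩
    refine Integrable.of_bound (C := M + M) (hgd.comp hmap).aestronglyMeasurable ?_
    exact Eventually.of_forall fun y => by rw [norm_norm]; exact hgb _
  refine e3.trans (le_of_eq ?_)
  rw [e1, setAverage_eq, smul_eq_mul, ← mul_assoc]
  congr 1
  have hVpos : 0 < V := by
    rw [hV, measureReal_def]
    exact ENNReal.toReal_pos (Metric.measure_ball_pos _ _ one_pos).ne' measure_ball_lt_top.ne
  rw [measureReal_def, Measure.addHaar_closedBall _ _ hr.le, ENNReal.toReal_mul,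
    ENNReal.toReal_ofReal (by positivity), ← measureReal_def, ← hV, Module.finrank_fin_fun]
  field_simp

/-- Extension of the convergence from countable dense families to all test functions. -/
lemma tendsto_of_dense {N : ℕ} {E : Type*} [NormedAddCommGroup E] [MeasurableSpace E]
    [BorelSpace E]
    (D : ℕ → C(Fin N → ℝ, ℝ))
    (hD : ∀ (f : C(Fin N → ℝ, ℝ)) (K : Set (Fin N → ℝ)), IsCompact K → ∀ ε > 0, ∃ n,
      ∀ x ∈ K, |f x - D n x| < ε)
    (Φ : ℕ → C₀(E, ℝ)) (hΦ : ∀ (φ : C₀(E, ℝ)), ∀ ε > 0, ∃ n, ∀ x, |φ x - Φ n x| ≤ ε)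
    (z : ℕ → (Fin N → ℝ) → E) (hz : ∀ k, Measurable (z k)) (ν : Measure E)
    [IsProbabilityMeasure ν]
    (H : ∀ m l, Tendsto (fun k => ∫ y in Metric.ball (0 : Fin N → ℝ) 1, D m y * Φ l (z k y)) atTop
      (𝓝 (∫ y in Metric.ball (0 : Fin N → ℝ) 1, D m y * ∫ ξ, Φ l ξ ∂ν)))
    (h : (Fin N → ℝ) → ℝ) (hh : IntegrableOn h (Metric.ball (0 : Fin N → ℝ) 1)) (φ : C₀(E, ℝ)) :
    Tendsto (fun k => ∫ y in Metric.ball (0 : Fin N → ℝ) 1, h y * φ (z k y)) atTop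
      (𝓝 (∫ y in Metric.ball (0 : Fin N → ℝ) 1, h y * ∫ ξ, φ ξ ∂ν)) := by
  set μ : Measure (Fin N → ℝ) := volume.restrict (Metric.ball (0 : Fin N → ℝ) 1) with hμ
  have : IsFiniteMeasure μ :=
    ⟨by rw [hμ, Measure.restrict_apply_univ]; exact measure_ball_lt_top⟩
  have hDi : ∀ f : C(Fin N → ℝ, ℝ), Integrable f μ := fun f =>
    (f.continuous.locallyIntegrable.integrableOn_isCompact
      (isCompact_closedBall (0 : Fin N → ℝ) 1)).mono_set Metric.ball_subset_closedBall
  have hφint : ∀ ψ : C₀(E, ℝ), Integrable ψ ν := fun ψ => by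
    obtain ⟨M, hM0, hM⟩ := abs_C0_le ψ
    exact Integrable.of_bound (C := M) ψ.continuous.measurable.aestronglyMeasurable
      (Eventually.of_forall hM)
  have habs : ∀ (ψ : C₀(E, ℝ)) (M : ℝ), (∀ x, |ψ x| ≤ M) → |∫ ξ, ψ ξ ∂ν| ≤ M := by
    intro ψ M hM
    have := norm_integral_le_of_norm_le_const (μ := ν) (f := ψ) (C := M) (Eventually.of_forall hM)
    simpa using this
  have hprod : ∀ (f : (Fin N → ℝ) → ℝ), Integrable f μ → ∀ (ψ : C₀(E, ℝ)) k,
      Integrable (fun y => f y * ψ (z k y)) μ := by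
    intro f hf ψ k
    obtain ⟨M, hM0, hM⟩ := abs_C0_le ψ
    exact hf.mul_bdd (c := M) (ψ.continuous.measurable.comp (hz k)).aestronglyMeasurable
      (Eventually.of_forall fun y => hM _)
  -- general estimate
  have est : ∀ (f : (Fin N → ℝ) → ℝ), Integrable f μ → ∀ (F : (Fin N → ℝ) → ℝ) (M : ℝ),
      (∀ y, |F y| ≤ M) → |∫ y, f y * F y ∂μ| ≤ M * ∫ y, ‖f y‖ ∂μ := by
    intro f hf F M hM
    rw [← integral_const_mul, ← Real.norm_eq_abs]
    refine norm_integral_le_of_norm_le (hf.norm.const_mul _) (Eventually.of_forall fun y => ?_)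
    rw [norm_mul, mul_comm]
    have := hM y
    rw [← Real.norm_eq_abs] at this
    gcongr
  -- step 1: all `φ`
  have step1 : ∀ m (φ : C₀(E, ℝ)), Tendsto (fun k => ∫ y, D m y * φ (z k y) ∂μ) atTop
      (𝓝 (∫ y, D m y * ∫ ξ, φ ξ ∂ν ∂μ)) := by
    intro m φ
    refine tendsto_of_approx fun ε hε => ?_
    set I := ∫ y, ‖D m y‖ ∂μ with hI
    have hI0 : 0 ≤ I := integral_nonneg fun _ => norm_nonneg _
    obtain ⟨l, hl⟩ := hΦ φ (ε / (I + 1)) (by positivity)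
    have hle : ε / (I + 1) * I ≤ ε := by
      rw [div_mul_eq_mul_div, div_le_iff₀ (by positivity)]; nlinarith
    refine ⟨_, _, H m l, fun k => ?_, ?_⟩
    · rw [← integral_sub (hprod _ (hDi _) _ _) (hprod _ (hDi _) _ _)]
      simp only [← mul_sub]
      exact (est _ (hDi _) _ _ fun y => hl _).trans hle
    · rw [← integral_sub ((hDi _).mul_const _) ((hDi _).mul_const _)]
      simp only [← mul_sub]
      refine (est _ (hDi _) _ _ fun y => ?_).trans hle
      rw [← integral_sub (hφint _) (hφint _)]
      exact habs (φ - Φ l) _ hl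
  obtain ⟨M, hM0, hM⟩ := abs_C0_le φ
  refine tendsto_of_approx fun ε hε => ?_
  obtain ⟨f, hf, hfi⟩ := Integrable.exists_boundedContinuous_integral_sub_le (μ := μ) hh
    (ε := ε / (2 * (M + 1))) (by positivity)
  set V := μ.real Set.univ with hV
  have hV0 : 0 ≤ V := measureReal_nonneg
  obtain ⟨m, hm⟩ := hD f.toContinuousMap _ (isCompact_closedBall (0 : Fin N → ℝ) 1)
    (ε / (2 * (M + 1) * (V + 1))) (by positivity)
  have i1 : Integrable (fun y => f y - D m y) μ := hfi.sub (hDi (D m))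
  have i2 : Integrable (fun y => h y - D m y) μ := Integrable.sub hh (hDi (D m))
  have i3 : Integrable (fun y => h y - f y) μ := Integrable.sub hh hfi
  have hfm : ∫ y, ‖f y - D m y‖ ∂μ ≤ ε / (2 * (M + 1)) := by
    have h1 : ∫ y, ‖f y - D m y‖ ∂μ ≤ ∫ y, ε / (2 * (M + 1) * (V + 1)) ∂μ := by
      refine integral_mono_ae i1.norm (integrable_const _) ?_
      filter_upwards [ae_restrict_mem measurableSet_ball] with y hy
      exact (hm y (Metric.ball_subset_closedBall hy)).le
    rw [integral_const, smul_eq_mul] at h1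
    refine h1.trans ?_
    rw [← hV, mul_div_assoc', div_le_div_iff₀ (by positivity) (by positivity)]
    have : 0 ≤ ε * (2 * (M + 1)) := by positivity
    nlinarith
  have hhm : ∫ y, ‖h y - D m y‖ ∂μ ≤ ε / (M + 1) := by
    have h1 : ∫ y, ‖h y - D m y‖ ∂μ ≤ ∫ y, (‖h y - f y‖ + ‖f y - D m y‖) ∂μ := by
      refine integral_mono i2.norm
        (i3.norm.add i1.norm) fun y => ?_
      exact norm_sub_le_norm_sub_add_norm_sub _ _ _
    rw [integral_add i3.norm i1.norm] at h1
    have : ε / (M + 1) = ε / (2 * (M + 1)) + ε / (2 * (M + 1)) := by field_simp; ring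
    linarith
  have hle : M * ∫ y, ‖h y - D m y‖ ∂μ ≤ ε := by
    calc M * ∫ y, ‖h y - D m y‖ ∂μ ≤ M * (ε / (M + 1)) := by gcongr
      _ ≤ ε := by rw [mul_div_assoc', div_le_iff₀ (by positivity)]; nlinarith
  refine ⟨_, _, step1 m φ, fun k => ?_, ?_⟩
  · rw [← integral_sub (hprod _ hh _ _) (hprod _ (hDi _) _ _)]
    simp only [← sub_mul]
    exact (est _ i2 _ _ fun y => hM _).trans hle
  · rw [← integral_sub (Integrable.mul_const hh _) ((hDi _).mul_const _)]
    simp only [← sub_mul]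
    exact (est _ i2 _ _ fun y => habs φ M hM).trans hle

lemma unitCube_isOpen (N : ℕ) : IsOpen (unitCube N) :=
  isOpen_set_pi Set.finite_univ fun _ _ => isOpen_Ioo

lemma unitCube_nonempty (N : ℕ) : (unitCube N).Nonempty :=
  ⟨fun _ => 1 / 2, fun _ _ => by norm_num⟩

lemma unitCube_subset_ball (N : ℕ) : unitCube N ⊆ Metric.ball 0 1 := by
  intro y hy
  rw [Metric.mem_ball, dist_zero_right, pi_norm_lt_iff one_pos]
  intro i
  have := hy i trivial
  rw [Real.norm_eq_abs, abs_lt]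
  exact ⟨by linarith [this.1], this.2⟩

/-- A homogeneous gradient Young measure is a gradient Young measure on the unit cube. -/
lemma homogeneous_on_cube {N d : ℕ} (ν : Measure (Fin d → Fin N → ℝ))
    (hν : IsHomogeneousGradientYM ν) : IsGradientYoungMeasure (unitCube N) (fun _ => ν) := by
  obtain ⟨hp, Ω, hΩo, ⟨a, ha⟩, -, u, ⟨C, hC⟩, hm, hY, hlim⟩ := hν
  obtain ⟨r, hr, hball⟩ := Metric.isOpen_iff.1 hΩo a ha
  have hsub : ∀ y ∈ unitCube N, a + r • y ∈ Ω := by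
    intro y hy
    have := unitCube_subset_ball N hy
    rw [Metric.mem_ball, dist_zero_right] at this
    apply hball
    rw [Metric.mem_ball, dist_self_add_left, norm_smul, Real.norm_of_nonneg hr.le]
    nlinarith
  choose w hw1 hw2 hw3 using fun j => exists_blowup (u j) C (hC j).1 a r hr
  refine ⟨w, ⟨C, fun j => ⟨hw1 j, hw2 j⟩⟩, fun j => gradMatrix_measurable _, ?_, ?_⟩
  · exact ⟨Eventually.of_forall fun _ => hp, fun φ => measurable_const⟩
  · intro h hh φ
    have := tendsto_scale (unitCube N) Ω (unitCube_isOpen N).measurableSet a r hr hsub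
      (fun j x => φ (gradMatrix (u j) x)) (fun _ => ∫ ξ, φ ξ ∂ν) (fun h hh => hlim h hh φ) h hh
    refine this.congr fun j => ?_
    refine setIntegral_congr_fun (unitCube_isOpen N).measurableSet fun y hy => ?_
    simp only [hw3 j y (unitCube_subset_ball N hy)]

/-- Localization: almost every `ν x` is a homogeneous gradient Young measure. -/
lemma localization {N d : ℕ} (ν : (Fin N → ℝ) → Measure (Fin d → Fin N → ℝ))
    (hν : IsGradientYoungMeasure (unitCube N) ν) :
    ∀ᵐ x ∂(volume.restrict (unitCube N)), IsHomogeneousGradientYM (ν x) := by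
  obtain ⟨u, ⟨C, hC⟩, hm, ⟨hp, hmeas⟩, hlim⟩ := hν
  obtain ⟨D, hD⟩ := exists_dense_seq_cont (Fin N → ℝ)
  obtain ⟨Φ, hΦ⟩ := exists_dense_seq_zero (Fin d → Fin N → ℝ)
  choose M hM0 hM using fun l => abs_C0_le (Φ l)
  let g : ℕ → (Fin N → ℝ) → ℝ := fun l x => max (-(M l)) (min (∫ ξ, Φ l ξ ∂(ν x)) (M l))
  have hgm : ∀ l, Measurable (g l) := fun l =>
    measurable_const.max ((hmeas (Φ l)).min measurable_const)
  have hgb : ∀ l x, |g l x| ≤ M l := fun l x =>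
    abs_le.2 ⟨le_max_left _ _, max_le (by linarith [hM0 l]) (min_le_right _ _)⟩
  have hgeq : ∀ l x, IsProbabilityMeasure (ν x) → g l x = ∫ ξ, Φ l ξ ∂(ν x) := by
    intro l x hx
    have h1 : |∫ ξ, Φ l ξ ∂(ν x)| ≤ M l := by
      have := norm_integral_le_of_norm_le_const (μ := ν x) (f := Φ l) (C := M l)
        (Eventually.of_forall (hM l))
      simpa using this
    rw [abs_le] at h1
    simp only [g]
    rw [min_eq_left h1.2, max_eq_right h1.1]
  have hlim' : ∀ l (h : (Fin N → ℝ) → ℝ), Integrable h (volume.restrict (unitCube N)) →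
      Tendsto (fun j => ∫ x in unitCube N, h x * Φ l (gradMatrix (u j) x)) atTop
        (𝓝 (∫ x in unitCube N, h x * g l x)) := by
    intro l h hh
    have e : ∫ x in unitCube N, h x * g l x = ∫ x in unitCube N, h x * ∫ ξ, Φ l ξ ∂(ν x) := by
      refine integral_congr_ae ?_
      filter_upwards [hp] with x hx
      rw [hgeq l x hx]
    rw [e]
    exact hlim h hh (Φ l)
  have hleb := ae_all_iff.2 fun l => lebesgue_blowup (g l) (hgm l) (M l) (hgb l)
  filter_upwards [hp, ae_restrict_of_ae hleb, ae_restrict_mem (unitCube_isOpen N).measurableSet]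
    with x hpx hx hxQ
  refine ⟨hpx, Metric.ball 0 1, Metric.isOpen_ball, ⟨0, by simp⟩, Metric.isBounded_ball, ?_⟩
  have hsub : ∀ᶠ r : ℝ in 𝓝[>] 0, ∀ y ∈ Metric.ball (0 : Fin N → ℝ) 1, x + r • y ∈ unitCube N := by
    obtain ⟨ρ, hρ, hball⟩ := Metric.isOpen_iff.1 (unitCube_isOpen N) x hxQ
    filter_upwards [Ioo_mem_nhdsGT hρ] with r hr y hy
    rw [Metric.mem_ball, dist_zero_right] at hy
    apply hball
    rw [Metric.mem_ball, dist_self_add_left, norm_smul, Real.norm_of_nonneg hr.1.le]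
    nlinarith [hr.1, hr.2]
  have hDi : ∀ f : C(Fin N → ℝ, ℝ), IntegrableOn f (Metric.ball (0 : Fin N → ℝ) 1) := fun f =>
    (f.continuous.locallyIntegrable.integrableOn_isCompact
      (isCompact_closedBall (0 : Fin N → ℝ) 1)).mono_set Metric.ball_subset_closedBall
  -- the diagonal argument
  have key : ∀ k : ℕ, ∃ (r : ℝ) (j : ℕ), 0 < r ∧ ∀ m ∈ Finset.range k, ∀ l ∈ Finset.range k,
      |(∫ y in Metric.ball (0 : Fin N → ℝ) 1, D m y * Φ l (gradMatrix (u j) (x + r • y))) -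
        ∫ y in Metric.ball (0 : Fin N → ℝ) 1, D m y * ∫ ξ, Φ l ξ ∂(ν x)| < 1 / ((k : ℝ) + 1) := by
    intro k
    have hk : (0 : ℝ) < 1 / ((k : ℝ) + 1) / 2 := by positivity
    have h1 : ∀ᶠ r : ℝ in 𝓝[>] 0, ∀ m ∈ Finset.range k, ∀ l ∈ Finset.range k,
        dist (∫ y in Metric.ball (0 : Fin N → ℝ) 1, D m y * g l (x + r • y))
          (∫ y in Metric.ball (0 : Fin N → ℝ) 1, D m y * g l x) < 1 / ((k : ℝ) + 1) / 2 := by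
      rw [eventually_all_finset]
      intro m _
      rw [eventually_all_finset]
      intro l _
      exact Metric.tendsto_nhds.1 (hx l (D m)) _ hk
    obtain ⟨r, ⟨hr1, hr2⟩, hr0⟩ := ((h1.and hsub).and self_mem_nhdsWithin).exists
    have hr0 : 0 < r := hr0
    have h2 : ∀ᶠ j in atTop, ∀ m ∈ Finset.range k, ∀ l ∈ Finset.range k,
        dist (∫ y in Metric.ball (0 : Fin N → ℝ) 1, D m y * Φ l (gradMatrix (u j) (x + r • y)))
          (∫ y in Metric.ball (0 : Fin N → ℝ) 1, D m y * g l (x + r • y))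
            < 1 / ((k : ℝ) + 1) / 2 := by
      rw [eventually_all_finset]
      intro m _
      rw [eventually_all_finset]
      intro l _
      exact Metric.tendsto_nhds.1 (tendsto_scale (Metric.ball 0 1) (unitCube N) measurableSet_ball
        x r hr0 hr2 (fun j x => Φ l (gradMatrix (u j) x)) (g l) (hlim' l) (D m) (hDi (D m))) _ hk
    obtain ⟨j, hj⟩ := h2.exists
    refine ⟨r, j, hr0, fun m hm l hl => ?_⟩
    have a1 := hr1 m hm l hl
    have a2 := hj m hm l hl
    rw [← Real.dist_eq, ← hgeq l x hpx]
    refine (dist_triangle _ _ _).trans_lt ((add_lt_add a2 a1).trans_eq (add_halves _))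
  choose r j hr0 hkey using key
  choose w hw1 hw2 hw3 using fun k => exists_blowup (u (j k)) C (hC (j k)).1 x (r k) (hr0 k)
  refine ⟨w, ⟨C, fun k => ⟨hw1 k, hw2 k⟩⟩, fun k => gradMatrix_measurable _, ?_, ?_⟩
  · exact ⟨Eventually.of_forall fun _ => hpx, fun φ => measurable_const⟩
  · intro h hh φ
    refine tendsto_of_dense D hD Φ hΦ (fun k y => gradMatrix (w k) y)
      (fun k => gradMatrix_measurable _) (ν x) (fun m l => ?_) h hh φ
    rw [tendsto_iff_dist_tendsto_zero]
    refine squeeze_zero' (Eventually.of_forall fun _ => dist_nonneg) ?_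
      (tendsto_one_div_add_atTop_nhds_zero_nat (𝕜 := ℝ))
    filter_upwards [eventually_gt_atTop m, eventually_gt_atTop l] with k hkm hkl
    have := hkey k m (Finset.mem_range.2 hkm) l (Finset.mem_range.2 hkl)
    rw [Real.dist_eq]
    refine le_trans (le_of_eq ?_) this.le
    congr 2
    refine setIntegral_congr_fun measurableSet_ball fun y hy => ?_
    simp only [hw3 k y hy]

/-- **Characterization of curl Young quasiconvexity.**
For a lower semicontinuous `f : ℝ^{d×N} → ℝ` bounded from below, the following are equivalent:
(i) for every `W^{1,∞}`-gradient Young measure `ν = {ν_x}` on the unit cube `Q`,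
`f([ν_x]) ≤ esssup_{y ∈ Q} (ν_y-esssup f)` for a.e. `x ∈ Q`;
(ii) `f([ν]) ≤ ν-esssup f` for every homogeneous `W^{1,∞}`-gradient Young measure `ν`. -/
theorem curlYoungQuasiconvex_iff_homogeneous {d N : ℕ}
    (f : (Fin d → Fin N → ℝ) → ℝ)
    (hflsc : LowerSemicontinuous f)
    (hfbdd : ∃ c : ℝ, ∀ ξ, c ≤ f ξ) :
    (∀ ν : (Fin N → ℝ) → Measure (Fin d → Fin N → ℝ),
      IsGradientYoungMeasure (unitCube N) ν →
      ∀ᵐ x ∂(volume.restrict (unitCube N)),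
        (f (∫ ξ, ξ ∂(ν x)) : EReal) ≤
          essSup (fun y => essSup (fun ξ => (f ξ : EReal)) (ν y))
            (volume.restrict (unitCube N))) ↔
    (∀ ν : Measure (Fin d → Fin N → ℝ), IsHomogeneousGradientYM ν →
      (f (∫ ξ, ξ ∂ν) : EReal) ≤ essSup (fun ξ => (f ξ : EReal)) ν) := by
  constructor
  · intro H ν hν
    have h1 := H (fun _ => ν) (homogeneous_on_cube ν hν)
    have hne : volume.restrict (unitCube N) ≠ 0 := by
      rw [Ne, Measure.restrict_eq_zero]
      exact ((unitCube_isOpen N).measure_pos volume (unitCube_nonempty N)).ne'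
    have : NeBot (ae (volume.restrict (unitCube N))) := ae_neBot.2 hne
    rw [essSup_const _ hne] at h1
    exact h1.exists.choose_spec
  · intro H ν hν
    filter_upwards [localization ν hν,
      ae_le_essSup (f := fun y => essSup (fun ξ => (f ξ : EReal)) (ν y))
        (μ := volume.restrict (unitCube N))] with x hx hx2
    exact (H (ν x) hx).trans hx2

end
end

section
/- Define h : [0,∞) → ℝ by h(t) = 0 for t ≤ 1, h(t) = t − 1 for 1 ≤ t ≤ 2, h(t) = 1 for t ≥ 2; k : ℝ^{2×2} → ℝ by k(Σ) = arctan(det Σ); and g : ℝ^{2×2} → ℝ by g(ξ) = max{h(|ξ|), k(ξ)}, where |ξ| is the Frobenius norm. Let W : ℝ^{2×2} × ℝ^{2×2} → [0,∞) be defined by W(ξ,η) = g(ξ) g(η). Then W is separately curl Young quasiconvex but W is not separately level convex. -/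
open MeasureTheory Filter Topology Bornology ZeroAtInfty NNReal ENNReal

noncomputable section

/-- `W` is separately level convex: all sublevel sets in each variable separately are convex. -/
def SeparatelyLevelConvex {E F : Type*} [AddCommMonoid E] [Module ℝ E]
    [AddCommMonoid F] [Module ℝ F] (W : E → F → ℝ) : Prop :=
  ∀ c : ℝ, (∀ η, Convex ℝ {ξ | W ξ η ≤ c}) ∧ (∀ ξ, Convex ℝ {η | W ξ η ≤ c})

/-- The auxiliary function `h : h(t) = 0` for `t ≤ 1`, `h(t) = t - 1` for `1 ≤ t ≤ 2`,
`h(t) = 1` for `t ≥ 2`. -/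
def hAux (t : ℝ) : ℝ := if t ≤ 1 then 0 else if t ≤ 2 then t - 1 else 1

/-- The Frobenius norm of a `2×2` matrix. -/
def frobNorm (ξ : Fin 2 → Fin 2 → ℝ) : ℝ := Real.sqrt (∑ i, ∑ j, (ξ i j) ^ 2)

/-- The function `g(ξ) = max{h(|ξ|), arctan(det ξ)}` on `2×2` matrices. -/
def gAux (ξ : Fin 2 → Fin 2 → ℝ) : ℝ :=
  max (hAux (frobNorm ξ)) (Real.arctan (Matrix.det (Matrix.of ξ)))

theorem nl_limit {w v : (Fin 2 → ℝ) → ℝ} {C D : ℝ≥0} (hw : LipschitzWith C w)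
    (hwc : HasCompactSupport w) (hv : LipschitzWith D v) (a b : Fin 2 → ℝ) :
    Tendsto (fun t : ℝ => ∫ x, (t⁻¹ * (w (x + t • a) - w x)) * (t⁻¹ * (v (x + t • b) - v x)))
      (𝓝[>] 0) (𝓝 (∫ x, lineDeriv ℝ w x a * lineDeriv ℝ v x b)) := by
  let K := Metric.cthickening (‖a‖) (tsupport w)
  have K_compact : IsCompact K := IsCompact.cthickening hwc
  have hwc' := hw.continuous
  have hvc' := hv.continuous
  apply tendsto_integral_filter_of_dominated_convergence
      (K.indicator (fun x ↦ (C * ‖a‖) * (D * ‖b‖)))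
  · filter_upwards with t
    apply Continuous.aestronglyMeasurable
    fun_prop
  · filter_upwards [Ioc_mem_nhdsGT zero_lt_one] with t ht
    have t_pos : 0 < t := ht.1
    have key : ∀ (f : (Fin 2 → ℝ) → ℝ) (C : ℝ≥0) (a x : Fin 2 → ℝ), LipschitzWith C f →
        ‖t⁻¹ * (f (x + t • a) - f x)‖ ≤ C * ‖a‖ := by
      intro f C a x hf
      calc ‖t⁻¹ * (f (x + t • a) - f x)‖
        = (t⁻¹ * ‖f (x + t • a) - f x‖) := by simp [norm_mul, t_pos.le]
      _ ≤ (t⁻¹ * (C * ‖(x + t • a) - x‖)) := by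
        gcongr; exact LipschitzWith.norm_sub_le hf (x + t • a) x
      _ = (C * ‖a‖) := by simp [field, norm_smul, abs_of_nonneg t_pos.le]
    filter_upwards with x
    by_cases hx : x ∈ K
    · rw [Set.indicator_of_mem hx, norm_mul]
      exact mul_le_mul (key _ _ _ _ hw) (key _ _ _ _ hv) (norm_nonneg _) (by positivity)
    · have A : w x = 0 := by
        rw [← Function.notMem_support]
        contrapose hx
        exact Metric.self_subset_cthickening _ (subset_tsupport _ hx)
      have B : w (x + t • a) = 0 := by
        rw [← Function.notMem_support]
        contrapose hx
        apply Metric.mem_cthickening_of_dist_le _ _ (‖a‖) (tsupport w) (subset_tsupport _ hx)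
        simp only [dist_eq_norm, sub_add_cancel_left, norm_neg, norm_smul, Real.norm_eq_abs,
          abs_of_nonneg t_pos.le]
        exact mul_le_of_le_one_left (norm_nonneg a) ht.2
      rw [Set.indicator_of_notMem hx]
      simp [A, B]
  · rw [integrable_indicator_iff K_compact.measurableSet]
    exact ContinuousOn.integrableOn_compact K_compact (by fun_prop)
  · filter_upwards [hw.ae_lineDifferentiableAt a, hv.ae_lineDifferentiableAt b] with x hx hx'
    exact hx.hasLineDerivAt.tendsto_slope_zero_right.mul
      hx'.hasLineDerivAt.tendsto_slope_zero_right

theorem nl_discrete {w v : (Fin 2 → ℝ) → ℝ} (hw : Continuous w)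
    (hwc : HasCompactSupport w) (hv : Continuous v) (a b : Fin 2 → ℝ) :
    ∫ x, (w (x + a) - w x) * (v (x - b) - v x) =
      (∫ x, w x * v (x - a - b)) - (∫ x, w x * v (x - a)) - (∫ x, w x * v (x - b))
        + ∫ x, w x * v x := by
  have hwa : HasCompactSupport (fun x => w (x + a)) :=
    hwc.comp_homeomorph (Homeomorph.addRight a)
  have i1 : Integrable (fun x => w (x + a) * v (x - b)) :=
    Continuous.integrable_of_hasCompactSupport (by fun_prop) hwa.mul_right
  have i2 : Integrable (fun x => w (x + a) * v x) :=
    Continuous.integrable_of_hasCompactSupport (by fun_prop) hwa.mul_right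
  have i3 : Integrable (fun x => w x * v (x - b)) :=
    Continuous.integrable_of_hasCompactSupport (by fun_prop) hwc.mul_right
  have i4 : Integrable (fun x => w x * v x) :=
    Continuous.integrable_of_hasCompactSupport (by fun_prop) hwc.mul_right
  have e : (fun x => (w (x + a) - w x) * (v (x - b) - v x)) = fun x =>
      w (x + a) * v (x - b) - w (x + a) * v x - w x * v (x - b) + w x * v x := by
    funext x; ring
  rw [e, integral_add (by exact (i1.sub i2).sub i3) i4, integral_sub (by exact i1.sub i2) i3,
    integral_sub i1 i2]
  rw [← integral_add_right_eq_self (fun x => w x * v (x - a - b)) a,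
    ← integral_add_right_eq_self (fun x => w x * v (x - a)) a]
  simp

/-- The null Lagrangian identity. -/
theorem nl_identity {w v : (Fin 2 → ℝ) → ℝ} {C D : ℝ≥0} (hw : LipschitzWith C w)
    (hwc : HasCompactSupport w) (hv : LipschitzWith D v) (a b : Fin 2 → ℝ) :
    ∫ x, lineDeriv ℝ w x a * lineDeriv ℝ v x b = ∫ x, lineDeriv ℝ w x b * lineDeriv ℝ v x a := by
  have h1 := nl_limit hw hwc hv a (-b)
  have h2 := nl_limit hw hwc hv b (-a)
  have e : (fun t : ℝ => ∫ x, (t⁻¹ * (w (x + t • a) - w x)) * (t⁻¹ * (v (x + t • -b) - v x)))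
    = (fun t : ℝ => ∫ x, (t⁻¹ * (w (x + t • b) - w x)) * (t⁻¹ * (v (x + t • -a) - v x))) := by
    funext t
    have r : ∀ a b : Fin 2 → ℝ,
        (∫ x, (t⁻¹ * (w (x + t • a) - w x)) * (t⁻¹ * (v (x + t • -b) - v x))) =
        t⁻¹ * t⁻¹ * ∫ x, (w (x + t • a) - w x) * (v (x - t • b) - v x) := by
      intro a b
      rw [← integral_const_mul]
      congr 1
      funext x
      rw [smul_neg, ← sub_eq_add_neg]; ring
    rw [r, r, nl_discrete hw.continuous hwc hv.continuous,
      nl_discrete hw.continuous hwc hv.continuous]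
    simp_rw [sub_sub, add_comm (t • b) (t • a)]
    ring
  rw [e] at h1
  have := tendsto_nhds_unique h1 h2
  simpa [lineDeriv_neg, integral_neg] using this

theorem le_essSup_of_pos {α : Type*} [MeasurableSpace α] (μ : Measure α) (f : α → EReal)
    (a : EReal) (h : μ {x | a ≤ f x} ≠ 0) : a ≤ essSup f μ := by
  by_contra hc
  push Not at hc
  have := ae_lt_of_essSup_lt hc
  rw [ae_iff] at this
  simp only [not_lt] at this
  exact h this

theorem hAux_mono : Monotone hAux := by
  intro s t hst
  unfold hAux
  split_ifs <;> linarith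

theorem hAux_nonneg (t : ℝ) : 0 ≤ hAux t := by
  unfold hAux
  split_ifs <;> linarith

theorem gAux_nonneg (ξ : Fin 2 → Fin 2 → ℝ) : 0 ≤ gAux ξ :=
  le_max_of_le_left (hAux_nonneg _)

theorem scyq_of_pos (H : ∀ ν : Measure (Fin 2 → Fin 2 → ℝ), IsHomogeneousGradientYM ν →
    ν {ξ | gAux (∫ ζ, ζ ∂ν) ≤ gAux ξ} ≠ 0) :
    SeparatelyCurlYoungQuasiconvex (fun ξ η : Fin 2 → Fin 2 → ℝ => gAux ξ * gAux η) := by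
  intro ν μ hν hμ
  apply le_essSup_of_pos
  refine fun h0 => H ν hν (measure_mono_null ?_ h0)
  intro ξ hξ
  apply le_essSup_of_pos
  refine fun h0 => H μ hμ (measure_mono_null ?_ h0)
  intro ζ hζ
  simp only [Set.mem_ofPred_eq] at *
  exact_mod_cast mul_le_mul hξ hζ (gAux_nonneg _) (gAux_nonneg _)

theorem not_slc : ¬ SeparatelyLevelConvex (fun ξ η : Fin 2 → Fin 2 → ℝ => gAux ξ * gAux η) := by
  intro h
  have e0 : gAux ![![4,0],![0,0]] = 1 := by
    have : frobNorm ![![4,0],![0,0]] = 4 := by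
      simp [frobNorm, Fin.sum_univ_two, Real.sqrt_sq]
    simp [gAux, this, hAux, Matrix.det_fin_two]
    norm_num
  have e1 : gAux ![![0,0],![0,4]] = 1 := by
    have : frobNorm ![![0,0],![0,4]] = 4 := by
      simp [frobNorm, Fin.sum_univ_two, Real.sqrt_sq]
    simp [gAux, this, hAux, Matrix.det_fin_two]
    norm_num
  have h1 := (h 1).1 ![![4,0],![0,0]]
  have := h1 (x := ![![4,0],![0,0]]) (by simp [e0]) (y := ![![0,0],![0,4]]) (by simp [e0, e1])
    (a := 1/2) (b := 1/2) (by norm_num) (by norm_num) (by norm_num)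
  simp only [Set.mem_ofPred_eq, e0, mul_one] at this
  have e2 : ((1/2 : ℝ) • ![![4,0],![0,0]] + (1/2 : ℝ) • ![![0,0],![0,4]] : Fin 2 → Fin 2 → ℝ)
      = ![![2,0],![0,2]] := by
    ext i j
    fin_cases i <;> fin_cases j <;> simp <;> norm_num
  rw [e2] at this
  have h2 : Real.arctan 4 ≤ 1 := by
    refine le_trans (le_trans (le_of_eq ?_) (le_max_right _ _)) this
    simp [Matrix.det_fin_two]; norm_num
  have h3 : Real.arctan (√3) = Real.pi / 3 := by
    rw [← Real.tan_pi_div_three]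
    exact Real.arctan_tan (by linarith [Real.pi_pos]) (by linarith [Real.pi_pos])
  have h4 : Real.arctan (√3) ≤ Real.arctan 4 := by
    apply Real.arctan_mono
    rw [Real.sqrt_le_left (by norm_num)]; norm_num
  linarith [Real.pi_gt_three]

theorem norm_single_one (k : Fin 2) : ‖(Pi.single k 1 : Fin 2 → ℝ)‖ = 1 := by
  rw [Pi.norm_single, norm_one]

/-- A compactly supported (in a ball) continuous function, as an element of `C₀`. -/
theorem exists_c0 (ψ : (Fin 2 → Fin 2 → ℝ) → ℝ) (hψ : Continuous ψ) (R : ℝ)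
    (h0 : ∀ ξ, R < ‖ξ‖ → ψ ξ = 0) : ∃ φ : C₀((Fin 2 → Fin 2 → ℝ), ℝ), ∀ ξ, φ ξ = ψ ξ := by
  have hc : HasCompactSupport ψ := by
    apply HasCompactSupport.intro (isCompact_closedBall (0 : Fin 2 → Fin 2 → ℝ) R)
    intro x hx
    apply h0
    simpa using hx
  exact ⟨⟨⟨ψ, hψ⟩, hc.is_zero_at_infty⟩, fun ξ => rfl⟩

theorem norm_gradMatrix_le {u : (Fin 2 → ℝ) → (Fin 2 → ℝ)} {C : ℝ≥0} (hu : LipschitzWith C u)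
    (x : Fin 2 → ℝ) : ‖gradMatrix u x‖ ≤ C := by
  rw [pi_norm_le_iff_of_nonneg C.coe_nonneg]
  intro i
  rw [pi_norm_le_iff_of_nonneg C.coe_nonneg]
  intro j
  calc ‖gradMatrix u x i j‖ ≤ ‖fderiv ℝ u x (Pi.single j 1)‖ := norm_le_pi_norm _ i
    _ ≤ ‖fderiv ℝ u x‖ * ‖(Pi.single j 1 : Fin 2 → ℝ)‖ := ContinuousLinearMap.le_opNorm _ _
    _ ≤ C * 1 := by
        gcongr
        · exact norm_fderiv_le_of_lipschitz ℝ hu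
        · exact (norm_single_one j).le
    _ = C := mul_one _

theorem ym_support_s9 {Ω : Set (Fin 2 → ℝ)} (hΩ : IsOpen Ω) (hne : Ω.Nonempty) (hb : IsBounded Ω)
    {ν : Measure (Fin 2 → Fin 2 → ℝ)} [IsProbabilityMeasure ν]
    {u : ℕ → (Fin 2 → ℝ) → (Fin 2 → ℝ)} {C : ℝ≥0} (hu : ∀ j, LipschitzWith C (u j))
    (hg : GeneratesYM (volume.restrict Ω) (fun j x => gradMatrix (u j) x) (fun _ => ν)) :
    ∀ᵐ ξ ∂ν, ‖ξ‖ ≤ C := by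
  have hfin : volume Ω ≠ ⊤ := hb.measure_lt_top.ne
  have hpos : volume.real Ω ≠ 0 := by
    rw [Measure.real, ENNReal.toReal_ne_zero]
    exact ⟨(hΩ.measure_pos volume hne).ne', hfin⟩
  have hn : ∀ n : ℕ, ∀ᵐ ξ ∂ν, max 0 (min (‖ξ‖ - C) (n - ‖ξ‖)) = 0 := by
    intro n
    set ψ : (Fin 2 → Fin 2 → ℝ) → ℝ := fun ξ => max 0 (min (‖ξ‖ - C) (n - ‖ξ‖)) with hψ
    have hψc : Continuous ψ := by fun_prop
    obtain ⟨φ, hφ⟩ := exists_c0 ψ hψc n (by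
      intro ξ hξ
      exact max_eq_left (le_trans (min_le_right _ _) (by linarith)))
    have ht := hg.2.2 (fun _ => 1) (by
      have : IsFiniteMeasure (volume.restrict Ω) := ⟨by simpa using hb.measure_lt_top⟩
      exact integrable_const _) φ
    have hz : ∀ j x, φ (gradMatrix (u j) x) = 0 := by
      intro j x
      rw [hφ]
      exact max_eq_left (le_trans (min_le_left _ _)
        (by linarith [norm_gradMatrix_le (hu j) x]))
    simp only [hz, mul_zero, integral_zero, one_mul, integral_const] at ht
    have h0 := tendsto_nhds_unique ht tendsto_const_nhds
    simp only [smul_eq_mul, mul_eq_zero, measureReal_restrict_apply_univ, hpos, false_or] at h0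
    simp only [hφ] at h0
    have hint : Integrable ψ ν := by
      refine Integrable.of_bound hψc.aestronglyMeasurable (n : ℝ) (ae_of_all _ fun ξ => ?_)
      rw [Real.norm_eq_abs, abs_of_nonneg (le_max_left _ _)]
      exact max_le (by positivity) (le_trans (min_le_right _ _) (by linarith [norm_nonneg ξ]))
    exact (integral_eq_zero_iff_of_nonneg (fun ξ => le_max_left _ _) hint).1 h0
  filter_upwards [ae_all_iff.2 hn] with ξ hξ
  by_contra hc
  push Not at hc
  obtain ⟨n, hn⟩ := exists_nat_gt ‖ξ‖
  have := hξ n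
  have h2 : 0 < min (‖ξ‖ - C) (n - ‖ξ‖) := lt_min (by linarith) (by linarith)
  have h3 := le_max_right 0 (min (‖ξ‖ - C) (n - ‖ξ‖))
  linarith

theorem ym_integrable {ν : Measure (Fin 2 → Fin 2 → ℝ)} [IsProbabilityMeasure ν] {C : ℝ≥0}
    (hs : ∀ᵐ ξ ∂ν, ‖ξ‖ ≤ C) {F : Type*} [NormedAddCommGroup F] [SecondCountableTopology F]
    {ψ : (Fin 2 → Fin 2 → ℝ) → F}
    (hψ : Continuous ψ) : Integrable ψ ν := by
  obtain ⟨M, hM⟩ := (isCompact_closedBall (0 : Fin 2 → Fin 2 → ℝ) C).exists_bound_of_continuousOn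
    hψ.continuousOn
  refine Integrable.of_bound hψ.aestronglyMeasurable M ?_
  filter_upwards [hs] with ξ hξ
  exact hM ξ (by simpa using hξ)

theorem ym_tendsto {Ω : Set (Fin 2 → ℝ)}
    {ν : Measure (Fin 2 → Fin 2 → ℝ)} [IsProbabilityMeasure ν]
    {u : ℕ → (Fin 2 → ℝ) → (Fin 2 → ℝ)} {C : ℝ≥0} (hu : ∀ j, LipschitzWith C (u j))
    (hg : GeneratesYM (volume.restrict Ω) (fun j x => gradMatrix (u j) x) (fun _ => ν))
    (hs : ∀ᵐ ξ ∂ν, ‖ξ‖ ≤ C) {ψ : (Fin 2 → Fin 2 → ℝ) → ℝ} (hψ : Continuous ψ)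
    {H : (Fin 2 → ℝ) → ℝ} (hH : Integrable H) (hH0 : ∀ x, x ∉ Ω → H x = 0) :
    Tendsto (fun j => ∫ x, H x * ψ (gradMatrix (u j) x)) atTop
      (𝓝 ((∫ x, H x) * ∫ ξ, ψ ξ ∂ν)) := by
  obtain ⟨φ, hφ⟩ := exists_c0 (fun ξ => max 0 (min 1 (C + 1 - ‖ξ‖)) * ψ ξ) (by fun_prop) (C + 1) (by
      intro ξ hξ
      rw [max_eq_left (le_trans (min_le_right _ _) (by linarith)), zero_mul])
  have hφ' : ∀ ξ, ‖ξ‖ ≤ C → φ ξ = ψ ξ := by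
    intro ξ hξ
    rw [hφ, min_eq_left (by linarith), max_eq_right zero_le_one, one_mul]
  have ht := hg.2.2 H hH.restrict φ
  beta_reduce at ht
  have e1 : ∫ ξ, φ ξ ∂ν = ∫ ξ, ψ ξ ∂ν := by
    apply integral_congr_ae
    filter_upwards [hs] with ξ hξ using hφ' ξ hξ
  rw [e1, integral_mul_const, setIntegral_eq_integral_of_forall_compl_eq_zero hH0] at ht
  refine ht.congr fun j => ?_
  rw [setIntegral_eq_integral_of_forall_compl_eq_zero
    (fun x hx => by rw [hH0 x hx, zero_mul])]
  simp only [hφ' _ (norm_gradMatrix_le (hu j) _)]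

theorem gradMatrix_ae {u : (Fin 2 → ℝ) → (Fin 2 → ℝ)} {C : ℝ≥0} (hu : LipschitzWith C u) :
    ∀ᵐ x, ∀ i k, gradMatrix u x i k = lineDeriv ℝ (fun y => u y i) x (Pi.single k 1) := by
  filter_upwards [hu.ae_differentiableAt] with x hx i k
  have h := (hasFDerivAt_pi'.1 hx.hasFDerivAt i).hasLineDerivAt (Pi.single k 1)
  rw [h.lineDeriv]
  rfl

theorem exists_subseq_limit {f : ℕ → (Fin 2 → ℝ) → ℝ} {C : ℝ≥0} (hf : ∀ j, LipschitzWith C (f j))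
    (hb : ∀ j x, ‖f j x‖ ≤ C) {K : Set (Fin 2 → ℝ)} (hK : IsCompact K) :
    ∃ (σ : ℕ → ℕ) (F : (Fin 2 → ℝ) → ℝ), StrictMono σ ∧
      ∀ x ∈ K, Tendsto (fun j => f (σ j) x) atTop (𝓝 (F x)) := by
  have : CompactSpace K := isCompact_iff_compactSpace.1 hK
  let g : ℕ → BoundedContinuousFunction K ℝ := fun j =>
    BoundedContinuousFunction.mkOfCompact ⟨fun x : K => f j x,
      (hf j).continuous.comp continuous_subtype_val⟩
  have hcomp := BoundedContinuousFunction.arzela_ascoli (Metric.closedBall (0 : ℝ) C)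
    (isCompact_closedBall _ _) (Set.range g) (by
      rintro _ x ⟨j, rfl⟩
      simpa [g] using hb j x) (by
      apply UniformEquicontinuous.equicontinuous
      apply LipschitzWith.uniformEquicontinuous _ C
      rintro ⟨_, j, rfl⟩
      exact fun x y => hf j x y)
  obtain ⟨G, -, σ, hσ, hlim⟩ := hcomp.tendsto_subseq (x := g)
    (fun j => subset_closure (Set.mem_range_self j))
  classical
  refine ⟨σ, fun x => if h : x ∈ K then G ⟨x, h⟩ else 0, hσ, fun x hx => ?_⟩
  simp only [hx, dite_true]
  exact ((continuous_eval_const (F := BoundedContinuousFunction K ℝ)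
    (⟨x, hx⟩ : K)).tendsto G).comp hlim

theorem integrable_of_bdd {K : Set (Fin 2 → ℝ)} (hK : IsCompact K) {F : (Fin 2 → ℝ) → ℝ}
    (hF : Measurable F) (M : ℝ) (hM : ∀ x, ‖F x‖ ≤ M) (h0 : ∀ x, x ∉ K → F x = 0) :
    Integrable F := by
  have h1 : IntegrableOn F K := by
    have : IsFiniteMeasure (volume.restrict K) := ⟨by simpa using hK.measure_lt_top⟩
    exact Integrable.of_bound hF.aestronglyMeasurable M (ae_of_all _ hM)
  exact h1.integrable_of_forall_notMem_eq_zero h0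

/-- integration by parts for the determinant, tested with `η`. -/
theorem det_ibp {η f v : (Fin 2 → ℝ) → ℝ} {C D L : ℝ≥0} (hη : LipschitzWith L η)
    {K : Set (Fin 2 → ℝ)} (hK : IsCompact K) (hηK : ∀ x, x ∉ K → η x = 0)
    (hf : LipschitzWith C f) (hfb : ∀ x, ‖f x‖ ≤ C) (hηb : ∀ x, ‖η x‖ ≤ L)
    (hηd : ∀ a x, x ∉ K → lineDeriv ℝ η x a = 0)
    (hv : LipschitzWith D v) (a b : Fin 2 → ℝ) :
    ∫ x, η x * (lineDeriv ℝ f x a * lineDeriv ℝ v x b - lineDeriv ℝ f x b * lineDeriv ℝ v x a) =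
      (∫ x, f x * lineDeriv ℝ η x b * lineDeriv ℝ v x a) -
      ∫ x, f x * lineDeriv ℝ η x a * lineDeriv ℝ v x b := by
  have hw : LipschitzWith (L * C + C * L) (fun x => η x * f x) := by
    apply LipschitzWith.of_dist_le_mul
    intro x y
    have h1 := hη.dist_le_mul x y
    have h2 := hf.dist_le_mul x y
    rw [Real.dist_eq] at *
    have e : η x * f x - η y * f y = η x * (f x - f y) + f y * (η x - η y) := by ring
    rw [e]
    have h3 := hfb y
    have h4 := hηb x
    rw [Real.norm_eq_abs] at h3 h4
    calc |η x * (f x - f y) + f y * (η x - η y)|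
        ≤ |η x| * |f x - f y| + |f y| * |η x - η y| := by
          rw [← abs_mul, ← abs_mul]; exact abs_add_le _ _
      _ ≤ L * (C * dist x y) + C * (L * dist x y) := by gcongr
      _ = _ := by push_cast; ring
  have hwc : HasCompactSupport (fun x => η x * f x) :=
    HasCompactSupport.intro hK fun x hx => by rw [hηK x hx, zero_mul]
  have key := nl_identity hw hwc hv a b
  have hm : ∀ {g : (Fin 2 → ℝ) → ℝ} (a : Fin 2 → ℝ), Continuous g →
      Measurable (fun x => lineDeriv ℝ g x a) := fun a hg => measurable_lineDeriv hg
  have hprod : ∀ a : Fin 2 → ℝ, ∀ᵐ x, lineDeriv ℝ (fun x => η x * f x) x a =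
      η x * lineDeriv ℝ f x a + f x * lineDeriv ℝ η x a := by
    intro a
    filter_upwards [hη.ae_lineDifferentiableAt a, hf.ae_lineDifferentiableAt a] with x hx1 hx2
    have := HasDerivAt.mul hx1.hasLineDerivAt hx2.hasLineDerivAt
    have h := HasDerivAt.deriv this
    simp only [zero_smul, add_zero] at h
    have e : lineDeriv ℝ (fun x => η x * f x) x a = lineDeriv ℝ η x a * f x + η x * lineDeriv ℝ f x a := h
    rw [e]; ring
  have hbd : ∀ {g : (Fin 2 → ℝ) → ℝ} {C : ℝ≥0} (a x : Fin 2 → ℝ), LipschitzWith C g →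
      ‖lineDeriv ℝ g x a‖ ≤ C * ‖a‖ := fun a x hg => norm_lineDeriv_le_of_lipschitz ℝ hg
  have hi1 : ∀ a b : Fin 2 → ℝ,
      Integrable (fun x => η x * (lineDeriv ℝ f x a * lineDeriv ℝ v x b)) := by
    intro a b
    refine integrable_of_bdd hK (hη.continuous.measurable.mul
      ((hm a hf.continuous).mul (hm b hv.continuous))) (L * ((C * ‖a‖) * (D * ‖b‖))) ?_ ?_
    · intro x
      rw [norm_mul, norm_mul]
      gcongr
      exacts [hηb x, hbd a x hf, hbd b x hv]
    · intro x hx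
      rw [hηK x hx, zero_mul]
  have hi2 : ∀ a b : Fin 2 → ℝ,
      Integrable (fun x => f x * lineDeriv ℝ η x a * lineDeriv ℝ v x b) := by
    intro a b
    refine integrable_of_bdd hK ((hf.continuous.measurable.mul
      (hm a hη.continuous)).mul (hm b hv.continuous)) (C * (L * ‖a‖) * (D * ‖b‖)) ?_ ?_
    · intro x
      rw [norm_mul, norm_mul]
      gcongr
      exacts [hfb x, hbd a x hη, hbd b x hv]
    · intro x hx
      rw [hηd a x hx, mul_zero, zero_mul]
  have hexp : ∀ a b : Fin 2 → ℝ, ∫ x, lineDeriv ℝ (fun x => η x * f x) x a * lineDeriv ℝ v x b =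
      (∫ x, η x * (lineDeriv ℝ f x a * lineDeriv ℝ v x b)) +
        ∫ x, f x * lineDeriv ℝ η x a * lineDeriv ℝ v x b := by
    intro a b
    rw [← integral_add (hi1 a b) (hi2 a b)]
    apply integral_congr_ae
    filter_upwards [hprod a] with x hx
    rw [hx]; ring
  rw [hexp, hexp] at key
  have e : (fun x => η x * (lineDeriv ℝ f x a * lineDeriv ℝ v x b -
      lineDeriv ℝ f x b * lineDeriv ℝ v x a)) = fun x =>
      η x * (lineDeriv ℝ f x a * lineDeriv ℝ v x b) -
      η x * (lineDeriv ℝ f x b * lineDeriv ℝ v x a) := by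
    funext x; ring
  rw [e, integral_sub (hi1 a b) (hi1 b a)]
  linarith

/-- cut-off -/
def cutOff (x0 : Fin 2 → ℝ) (r : ℝ) (x : Fin 2 → ℝ) : ℝ := max 0 (r - dist x x0)

theorem cutOff_lip (x0 : Fin 2 → ℝ) (r : ℝ) : LipschitzWith 1 (cutOff x0 r) := by
  apply LipschitzWith.of_dist_le_mul
  intro x y
  rw [Real.dist_eq, NNReal.coe_one, one_mul]
  unfold cutOff
  have h1 := abs_dist_sub_le x y x0
  calc |max 0 (r - dist x x0) - max 0 (r - dist y x0)|
      ≤ |(r - dist x x0) - (r - dist y x0)| := by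
        rw [max_comm 0, max_comm 0]; exact abs_max_sub_max_le_abs _ _ _
    _ = |dist x x0 - dist y x0| := by rw [abs_sub_comm]; congr 1; ring
    _ ≤ _ := h1

theorem cutOff_zero {x0 : Fin 2 → ℝ} {r : ℝ} {x : Fin 2 → ℝ} (hx : x ∉ Metric.closedBall x0 r) :
    cutOff x0 r x = 0 := by
  rw [Metric.mem_closedBall, not_le] at hx
  exact max_eq_left (by linarith)

theorem cutOff_lineDeriv {x0 : Fin 2 → ℝ} {r : ℝ} {x : Fin 2 → ℝ} (a : Fin 2 → ℝ)
    (hx : x ∉ Metric.closedBall x0 r) : lineDeriv ℝ (cutOff x0 r) x a = 0 := by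
  have h : cutOff x0 r =ᶠ[𝓝 x] fun _ => 0 := by
    filter_upwards [Metric.isClosed_closedBall.isOpen_compl.mem_nhds hx] with y hy
    exact cutOff_zero hy
  rw [h.lineDeriv_eq]
  simp [lineDeriv]

theorem ym_det {ν : Measure (Fin 2 → Fin 2 → ℝ)} [IsProbabilityMeasure ν]
    {Ω : Set (Fin 2 → ℝ)} (hΩ : IsOpen Ω) (hne : Ω.Nonempty)
    {u : ℕ → (Fin 2 → ℝ) → (Fin 2 → ℝ)} {C : ℝ≥0} (hu : ∀ j, LipschitzWith C (u j))
    (hub : ∀ j x, ‖u j x‖ ≤ C)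
    (hg : GeneratesYM (volume.restrict Ω) (fun j x => gradMatrix (u j) x) (fun _ => ν))
    (hs : ∀ᵐ ξ ∂ν, ‖ξ‖ ≤ C) :
    ∫ ξ, (ξ 0 0 * ξ 1 1 - ξ 0 1 * ξ 1 0) ∂ν =
      (∫ ξ, ξ 0 0 ∂ν) * (∫ ξ, ξ 1 1 ∂ν) - (∫ ξ, ξ 0 1 ∂ν) * (∫ ξ, ξ 1 0 ∂ν) := by
  obtain ⟨x0, hx0⟩ := hne
  obtain ⟨r', hr', hball'⟩ := Metric.nhds_basis_closedBall.mem_iff.1 (hΩ.mem_nhds hx0)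
  obtain ⟨r, hr, hr1, hball⟩ : ∃ r : ℝ, 0 < r ∧ r ≤ 1 ∧ Metric.closedBall x0 r ⊆ Ω :=
    ⟨min r' 1, lt_min hr' one_pos, min_le_right _ _,
      (Metric.closedBall_subset_closedBall (min_le_left _ _)).trans hball'⟩
  set K := Metric.closedBall x0 r with hKdef
  have hK : IsCompact K := isCompact_closedBall _ _
  set η := cutOff x0 r with hηdef
  have hη : LipschitzWith 1 η := cutOff_lip x0 r
  have hη0 : ∀ x, x ∉ K → η x = 0 := fun x hx => cutOff_zero hx
  have hηd : ∀ a x, x ∉ K → lineDeriv ℝ η x a = 0 := fun a x hx => cutOff_lineDeriv a hx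
  have hηnn : ∀ x, 0 ≤ η x := fun x => le_max_left _ _
  have hηb : ∀ x, ‖η x‖ ≤ (1 : ℝ≥0) := fun x => by
    rw [Real.norm_eq_abs, abs_of_nonneg (hηnn x)]
    exact max_le zero_le_one (by rw [NNReal.coe_one]; linarith [dist_nonneg (x := x) (y := x0)])
  have hηcs : HasCompactSupport η := HasCompactSupport.intro hK hη0
  have hηi : Integrable η := hη.continuous.integrable_of_hasCompactSupport hηcs
  have hI : 0 < ∫ x, η x :=
    hη.continuous.integral_pos_of_hasCompactSupport_nonneg_nonzero hηcs hηnn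
      (x := x0) (by simp [hηdef, cutOff]; linarith)
  set I := ∫ x, η x with hIdef
  -- components
  have hcl : ∀ j i, LipschitzWith C (fun y => u j y i) := fun j i =>
    LipschitzWith.of_dist_le_mul fun x y =>
      (dist_le_pi_dist (u j x) (u j y) i).trans ((hu j).dist_le_mul x y)
  have hcb : ∀ j i x, ‖u j x i‖ ≤ C := fun j i x => (norm_le_pi_norm _ i).trans (hub j x)
  obtain ⟨σ, f, hσ, hlim⟩ := exists_subseq_limit (fun j => hcl j 0) (fun j x => hcb j 0 x) hK
  have hσt := hσ.tendsto_atTop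
  set e : Fin 2 → (Fin 2 → ℝ) := fun k => Pi.single k 1 with he
  have hne : ∀ k, ‖e k‖ = 1 := fun k => norm_single_one k
  -- the limit function, cut off
  set fK : (Fin 2 → ℝ) → ℝ := K.indicator f with hfK
  have hfKlim : ∀ x, Tendsto (fun j => K.indicator (fun y => u (σ j) y 0) x) atTop (𝓝 (fK x)) := by
    intro x
    by_cases hx : x ∈ K
    · simpa [hfK, hx] using hlim x hx
    · simp [hfK, hx]
  have hfKm : Measurable fK := by
    refine measurable_of_tendsto_metrizable (f := fun j => K.indicator (fun y => u (σ j) y 0))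
      (fun j => ?_) (tendsto_pi_nhds.2 hfKlim)
    exact (hcl _ 0).continuous.measurable.indicator hK.measurableSet
  have hfKb : ∀ x, ‖fK x‖ ≤ C := by
    intro x
    by_cases hx : x ∈ K
    · refine le_of_tendsto (hfKlim x).norm (Eventually.of_forall fun j => ?_)
      simpa [hx] using hcb (σ j) 0 x
    · simp [hfK, hx]
  have hηdm : ∀ k, Measurable (fun x => lineDeriv ℝ η x (e k)) := fun k =>
    measurable_lineDeriv hη.continuous
  have hηdb : ∀ k x, ‖lineDeriv ℝ η x (e k)‖ ≤ 1 := fun k x => by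
    have := norm_lineDeriv_le_of_lipschitz ℝ hη (x₀ := x) (v := e k)
    simpa [hne] using this
  set H : Fin 2 → (Fin 2 → ℝ) → ℝ := fun k x => fK x * lineDeriv ℝ η x (e k) with hH
  have hHi : ∀ k, Integrable (H k) := by
    intro k
    refine integrable_of_bdd hK (hfKm.mul (hηdm k)) (C * 1) ?_ ?_
    · intro x
      rw [hH, norm_mul]
      gcongr
      exacts [hfKb x, hηdb k x]
    · intro x hx
      simp only [hH, hηd _ x hx, mul_zero]
  -- strong convergence
  have hstrong : ∀ k, ∀ (G : ℕ → (Fin 2 → ℝ) → ℝ) (M : ℝ), (∀ j, Measurable (G j)) →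
      (∀ j x, ‖G j x‖ ≤ M) →
      Tendsto (fun j => ∫ x, (u (σ j) x 0 * lineDeriv ℝ η x (e k) * G j x - H k x * G j x))
        atTop (𝓝 0) := by
    intro k G M hGm hGb
    have : (0 : ℝ) = ∫ x : Fin 2 → ℝ, (0 : ℝ) := by simp
    rw [this]
    have hM : 0 ≤ M := (norm_nonneg _).trans (hGb 0 0)
    apply tendsto_integral_of_dominated_convergence (K.indicator fun _ => 2 * C * M)
    · intro j
      exact (((((hcl _ 0).continuous.measurable).mul (hηdm k)).mul (hGm j)).sub
        ((hfKm.mul (hηdm k)).mul (hGm j))).aestronglyMeasurable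
    · rw [integrable_indicator_iff hK.measurableSet]
      exact ContinuousOn.integrableOn_compact hK (by fun_prop)
    · intro j
      filter_upwards with x
      by_cases hx : x ∈ K
      · rw [Set.indicator_of_mem hx]
        have e1 : u (σ j) x 0 * lineDeriv ℝ η x (e k) * G j x - H k x * G j x =
          (u (σ j) x 0 - fK x) * lineDeriv ℝ η x (e k) * G j x := by simp only [hH]; ring
        rw [e1, norm_mul, norm_mul]
        calc _ ≤ (C + C) * 1 * M := by
              gcongr
              · exact (norm_sub_le _ _).trans (add_le_add (hcb _ _ _) (hfKb x))
              · exact hηdb k x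
              · exact hGb j x
          _ = _ := by ring
      · rw [Set.indicator_of_notMem hx]
        simp [hH, hηd _ x hx]
    · filter_upwards with x
      by_cases hx : x ∈ K
      · have e1 : ∀ j, u (σ j) x 0 * lineDeriv ℝ η x (e k) * G j x - H k x * G j x =
          (u (σ j) x 0 - fK x) * (lineDeriv ℝ η x (e k) * G j x) := fun j => by
            simp only [hH]; ring
        simp_rw [e1]
        refine Tendsto.zero_mul_isBoundedUnder_le ?_ ?_
        · have := (hlim x hx).sub_const (fK x)
          simpa [hfK, hx] using this
        · refine isBoundedUnder_of ⟨1 * M, fun j => ?_⟩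
          simp only [Function.comp, norm_mul]
          exact mul_le_mul (hηdb k x) (hGb j x) (norm_nonneg _) zero_le_one
      · simp [hH, hηd _ x hx]
  have hui : ∀ k, ∀ (j : ℕ) (G : (Fin 2 → ℝ) → ℝ) (M : ℝ), Measurable G →
      (∀ x, ‖G x‖ ≤ M) →
      Integrable (fun x => u (σ j) x 0 * lineDeriv ℝ η x (e k) * G x) := by
    intro k j G M hGm hGb
    refine integrable_of_bdd hK ((((hcl _ 0).continuous.measurable).mul (hηdm k)).mul hGm)
      (C * 1 * M) ?_ ?_
    · intro x
      rw [norm_mul, norm_mul]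
      gcongr
      exacts [hcb _ _ _, hηdb k x, hGb x]
    · intro x hx
      simp only [hηd _ x hx, mul_zero, zero_mul]
  have hHGi : ∀ k, ∀ (G : (Fin 2 → ℝ) → ℝ) (M : ℝ), Measurable G →
      (∀ x, ‖G x‖ ≤ M) → Integrable (fun x => H k x * G x) := by
    intro k G M hGm hGb
    refine integrable_of_bdd hK ((hfKm.mul (hηdm k)).mul hGm) (C * 1 * M) ?_ ?_
    · intro x
      simp only [hH]
      rw [norm_mul, norm_mul]
      gcongr
      exacts [hfKb x, hηdb k x, hGb x]
    · intro x hx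
      simp only [hH, hηd _ x hx, mul_zero, zero_mul]
  -- the integrals of `H k`
  have hHint : ∀ k, ∫ x, H k x = -(I * ∫ ξ, ξ 0 k ∂ν) := by
    intro k
    have h1 := hstrong k (fun _ _ => 1) 1 (fun _ => measurable_const) (fun _ _ => by simp)
    have h2 := (ym_tendsto hu hg hs (ψ := fun ξ => ξ 0 k) (by fun_prop) hηi
      (fun x hx => hη0 x fun h => hx (hball h))).comp hσt
    have h3 : ∀ j, ∫ x, (u (σ j) x 0 * lineDeriv ℝ η x (e k) * 1 - H k x * 1) =
        -(∫ x, η x * gradMatrix (u (σ j)) x 0 k) - ∫ x, H k x := by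
      intro j
      rw [integral_sub (hui k j (fun _ => 1) 1 measurable_const (fun _ => by simp))
        (hHGi k (fun _ => 1) 1 measurable_const (fun _ => by simp))]
      simp only [mul_one]
      congr 1
      have h4 := (hcl (σ j) 0).integral_lineDeriv_mul_eq (μ := volume) hη hηcs (e k)
      have h5 : ∫ x, η x * gradMatrix (u (σ j)) x 0 k =
          ∫ x, lineDeriv ℝ (fun y => u (σ j) y 0) x (e k) * η x := by
        apply integral_congr_ae
        filter_upwards [gradMatrix_ae (hu (σ j))] with x hx
        rw [hx, mul_comm]
      rw [h5, h4, ← integral_neg]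
      congr 1
      funext x
      rw [lineDeriv_neg]; ring
    simp only [h3] at h1
    have h6 := tendsto_nhds_unique h1 ((h2.neg).sub_const (∫ x, H k x))
    linarith
  have hB : ∀ k l, Tendsto (fun j => ∫ x, u (σ j) x 0 * lineDeriv ℝ η x (e k) *
      lineDeriv ℝ (fun y => u (σ j) y 1) x (e l)) atTop
      (𝓝 (-(I * ∫ ξ, ξ 0 k ∂ν) * ∫ ξ, ξ 1 l ∂ν)) := by
    intro k l
    have hGm : ∀ j, Measurable (fun x => lineDeriv ℝ (fun y => u (σ j) y 1) x (e l)) := fun j =>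
      measurable_lineDeriv (hcl (σ j) 1).continuous
    have hGb : ∀ j x, ‖lineDeriv ℝ (fun y => u (σ j) y 1) x (e l)‖ ≤ C := fun j x => by
      have := norm_lineDeriv_le_of_lipschitz ℝ (hcl (σ j) 1) (x₀ := x) (v := e l)
      simpa [hne] using this
    have h1 := hstrong k (fun j x => lineDeriv ℝ (fun y => u (σ j) y 1) x (e l)) C hGm hGb
    have h2 := (ym_tendsto hu hg hs (ψ := fun ξ => ξ 1 l) (by fun_prop) (hHi k)
      (fun x hx => by
        have : x ∉ K := fun h => hx (hball h)
        simp only [hH, hηd _ x this, mul_zero])).comp hσt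
    rw [← hHint k]
    have h3 := h1.add h2
    rw [zero_add] at h3
    refine h3.congr fun j => ?_
    rw [integral_sub (hui k j _ C (hGm j) (hGb j)) (hHGi k _ C (hGm j) (hGb j))]
    have h5 : ∫ x, H k x * gradMatrix (u (σ j)) x 1 l =
        ∫ x, H k x * lineDeriv ℝ (fun y => u (σ j) y 1) x (e l) := by
      apply integral_congr_ae
      filter_upwards [gradMatrix_ae (hu (σ j))] with x hx
      rw [hx]
    simp only [Function.comp, h5]
    ring
  have hD := (ym_tendsto hu hg hs (ψ := fun ξ => ξ 0 0 * ξ 1 1 - ξ 0 1 * ξ 1 0) (by fun_prop) hηi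
      (fun x hx => hη0 x fun h => hx (hball h))).comp hσt
  have hDeq : ∀ j, ∫ x, η x * (gradMatrix (u (σ j)) x 0 0 * gradMatrix (u (σ j)) x 1 1 -
      gradMatrix (u (σ j)) x 0 1 * gradMatrix (u (σ j)) x 1 0) =
      (∫ x, u (σ j) x 0 * lineDeriv ℝ η x (e 1) * lineDeriv ℝ (fun y => u (σ j) y 1) x (e 0)) -
      ∫ x, u (σ j) x 0 * lineDeriv ℝ η x (e 0) * lineDeriv ℝ (fun y => u (σ j) y 1) x (e 1) := by
    intro j
    rw [← det_ibp hη hK hη0 (hcl (σ j) 0) (hcb (σ j) 0) hηb hηd (hcl (σ j) 1) (e 0) (e 1)]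
    apply integral_congr_ae
    filter_upwards [gradMatrix_ae (hu (σ j))] with x hx
    simp only [hx, he]
  have hfin := tendsto_nhds_unique hD (((hB 1 0).sub (hB 0 1)).congr fun j => (hDeq j).symm)
  have : I * (∫ ξ, (ξ 0 0 * ξ 1 1 - ξ 0 1 * ξ 1 0) ∂ν) =
      I * ((∫ ξ, ξ 0 0 ∂ν) * (∫ ξ, ξ 1 1 ∂ν) - (∫ ξ, ξ 0 1 ∂ν) * (∫ ξ, ξ 1 0 ∂ν)) := by
    rw [hfin]; ring
  exact mul_left_cancel₀ hI.ne' this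

theorem ym_pos (ν : Measure (Fin 2 → Fin 2 → ℝ)) (hν : IsHomogeneousGradientYM ν) :
    ν {ξ | gAux (∫ ζ, ζ ∂ν) ≤ gAux ξ} ≠ 0 := by
  obtain ⟨hp, Ω, hΩ, hne, hb, u, ⟨C, hC⟩, hg⟩ := hν
  have hs := ym_support_s9 hΩ hne hb (fun j => (hC j).1) hg
  have hdet := ym_det hΩ hne (fun j => (hC j).1) (fun j => (hC j).2) hg hs
  have hid : Integrable (fun ξ : Fin 2 → Fin 2 → ℝ => ξ) ν := ym_integrable hs continuous_id
  set F := ∫ ζ, ζ ∂ν with hF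
  have hcomp : ∀ i k, ∫ ξ, ξ i k ∂ν = F i k := by
    intro i k
    have := ((ContinuousLinearMap.proj (R := ℝ) (φ := fun _ : Fin 2 => ℝ) k).comp
      (ContinuousLinearMap.proj (R := ℝ) (φ := fun _ : Fin 2 => (Fin 2 → ℝ)) i)).integral_comp_comm
      hid
    simpa using this
  rcases le_total (Real.arctan (Matrix.det (Matrix.of F))) (hAux (frobNorm F)) with h | h
  · have hint : Integrable (fun ξ : Fin 2 → Fin 2 → ℝ =>
        F 0 0 * ξ 0 0 + F 0 1 * ξ 0 1 + F 1 0 * ξ 1 0 + F 1 1 * ξ 1 1) ν :=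
      ym_integrable hs (by fun_prop)
    have hpos := measure_integral_le_pos hint
    have hc : ∀ i k, Integrable (fun ξ : Fin 2 → Fin 2 → ℝ => F i k * ξ i k) ν := fun i k =>
      ym_integrable hs (by fun_prop)
    have hval : ∫ ξ, (F 0 0 * ξ 0 0 + F 0 1 * ξ 0 1 + F 1 0 * ξ 1 0 + F 1 1 * ξ 1 1) ∂ν =
        F 0 0 * F 0 0 + F 0 1 * F 0 1 + F 1 0 * F 1 0 + F 1 1 * F 1 1 := by
      rw [integral_add (by exact ((hc 0 0).add (hc 0 1)).add (hc 1 0)) (hc 1 1),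
        integral_add (by exact (hc 0 0).add (hc 0 1)) (hc 1 0), integral_add (hc 0 0) (hc 0 1)]
      simp only [integral_const_mul, hcomp]
    refine fun h0 => hpos.ne' (measure_mono_null ?_ h0)
    intro ξ hξ
    rw [hval] at hξ
    rw [Set.mem_ofPred_eq] at hξ
    rw [Set.mem_ofPred_eq]
    have : gAux F = hAux (frobNorm F) := max_eq_left h
    rw [this]
    refine le_trans (hAux_mono ?_) (le_max_left _ _)
    apply Real.sqrt_le_sqrt
    simp only [Fin.sum_univ_two]
    nlinarith [sq_nonneg (F 0 0 - ξ 0 0), sq_nonneg (F 0 1 - ξ 0 1), sq_nonneg (F 1 0 - ξ 1 0),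
      sq_nonneg (F 1 1 - ξ 1 1)]
  · have hint : Integrable (fun ξ : Fin 2 → Fin 2 → ℝ => ξ 0 0 * ξ 1 1 - ξ 0 1 * ξ 1 0) ν :=
      ym_integrable hs (by fun_prop)
    have hpos := measure_integral_le_pos hint
    refine fun h0 => hpos.ne' (measure_mono_null ?_ h0)
    intro ξ hξ
    rw [hdet] at hξ
    simp only [hcomp] at hξ
    rw [Set.mem_ofPred_eq] at hξ
    rw [Set.mem_ofPred_eq]
    have : gAux F = Real.arctan (Matrix.det (Matrix.of F)) := max_eq_right h
    rw [this]
    refine le_trans (Real.arctan_mono ?_) (le_max_right _ _)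
    simpa [Matrix.det_fin_two] using hξ

/-- **Example.**  The function `W(ξ,η) = g(ξ) g(η)` with
`g(ξ) = max{h(|ξ|), arctan(det ξ)}` is separately curl Young quasiconvex but not separately
level convex. -/
theorem example_separatelyCurlYoungQuasiconvex_not_separatelyLevelConvex :
    SeparatelyCurlYoungQuasiconvex (fun ξ η : Fin 2 → Fin 2 → ℝ => gAux ξ * gAux η) ∧
    ¬ SeparatelyLevelConvex (fun ξ η : Fin 2 → Fin 2 → ℝ => gAux ξ * gAux η) := by
  exact ⟨scyq_of_pos ym_pos, not_slc⟩

end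
end
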